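/- Let p ∈ {0} ∪ [1,∞) and let μ_n, μ ∈ P_p(ℝ^N), n ∈ ℕ. Then the following are equivalent: (i) AW_p(μ_n, μ) → 0; (ii) KR_p(μ_n, μ) → 0; (iii) the quantile processes converge, Q^{μ_n} → Q^μ in L_p(λ^N; ℝ^N) (for p = 0: in λ^N-probability). In other words, the Knothe–Rosenblatt distance KR_p metrizes the p-adapted weak topology on P_p(ℝ^N). -/

import Mathlib

open MeasureTheory ProbabilityTheory Filter Set
open scoped ENNReal NNReal Topology

/-- Lebesgue measure on `(0,1)`. -/
noncomputable def lambda01 : Measure ℝ := volume.restrict (Set.Ioo (0:ℝ) 1)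

/-- The `N`-fold product of Lebesgue measure on `(0,1)`. -/
noncomputable def lambdaN (N : ℕ) : Measure (Fin N → ℝ) :=
  Measure.pi fun _ => lambda01

/-- The open unit cube `(0,1)^N`. -/
def cube (N : ℕ) : Set (Fin N → ℝ) := {u | ∀ i, u i ∈ Set.Ioo (0:ℝ) 1}

/-- A map is triangular (adapted) if its `k`-th component depends only on the first `k`
coordinates. -/
def Triangular {N : ℕ} (Q : (Fin N → ℝ) → Fin N → ℝ) : Prop :=
  ∀ (k : Fin N) (u v : Fin N → ℝ), (∀ j ≤ k, u j = v j) → Q u k = Q v k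

/-- Monotonicity condition (inc) on a set `s`: the `k`-th component is increasing in the
`k`-th coordinate (the earlier coordinates being fixed). -/
def IncOn {N : ℕ} (Q : (Fin N → ℝ) → Fin N → ℝ) (s : Set (Fin N → ℝ)) : Prop :=
  ∀ k : Fin N, ∀ u ∈ s, ∀ v ∈ s, (∀ j < k, u j = v j) → u k ≤ v k → Q u k ≤ Q v k

/-- Strict monotonicity condition (sinc) on a set `s`. -/
def StrictIncOn {N : ℕ} (Q : (Fin N → ℝ) → Fin N → ℝ) (s : Set (Fin N → ℝ)) : Prop :=
  ∀ k : Fin N, ∀ u ∈ s, ∀ v ∈ s, (∀ j < k, u j = v j) → u k < v k → Q u k < Q v k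

/-- Consistency condition (con) on a set `s`: if changing only the `k`-th coordinate does not
change the `k`-th component, then it does not change any later component `m ≥ k`. -/
def ConOn {N : ℕ} (Q : (Fin N → ℝ) → Fin N → ℝ) (s : Set (Fin N → ℝ)) : Prop :=
  ∀ k m : Fin N, k ≤ m → ∀ u ∈ s, ∀ v ∈ s, (∀ j ≠ k, u j = v j) →
    Q u k = Q v k → Q u m = Q v m

/-- A quantile process: a Borel triangular map satisfying (inc) and (con) on the unit cube. -/
structure IsQuantileProcess {N : ℕ} (Q : (Fin N → ℝ) → Fin N → ℝ) : Prop where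
  measurable : Measurable Q
  triangular : Triangular Q
  inc : IncOn Q (cube N)
  con : ConOn Q (cube N)

/-- The (a.e. unique) quantile process of `μ`, chosen via Hilbert's epsilon operator. -/
noncomputable def quantileProcess {N : ℕ} (μ : Measure (Fin N → ℝ)) :
    (Fin N → ℝ) → Fin N → ℝ :=
  Classical.epsilon fun Q => IsQuantileProcess Q ∧ (lambdaN N).map Q = μ

/-- The cost `|x - y|_p^p = ∑ₖ |xₖ - yₖ|^p`, valued in `ℝ≥0∞`. -/
noncomputable def pCost (p : ℝ) {N : ℕ} (x y : Fin N → ℝ) : ℝ≥0∞ :=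
  ∑ k, ENNReal.ofReal (|x k - y k| ^ p)

/-- The bounded cost `|x - y| ∧ 1` used for `p = 0`. -/
noncomputable def cost0 {N : ℕ} (x y : Fin N → ℝ) : ℝ≥0∞ :=
  ENNReal.ofReal (min ‖x - y‖ 1)

/-- The `L_p(λ^N; ℝ^N)`-distance of two maps `(0,1)^N → ℝ^N`
(for `p = 0` the distance `∫ |f - g| ∧ 1 dλ^N` of convergence in probability). -/
noncomputable def Ldist (p : ℝ) {N : ℕ} (f g : (Fin N → ℝ) → Fin N → ℝ) : ℝ≥0∞ :=
  if p = 0 then ∫⁻ u, cost0 (f u) (g u) ∂(lambdaN N)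
  else (∫⁻ u, pCost p (f u) (g u) ∂(lambdaN N)) ^ p⁻¹

/-- `μ ∈ P_p(ℝ^N)`: a Borel probability measure with finite `p`-th moments
(no moment condition when `p = 0`). -/
def MemPp (p : ℝ) {N : ℕ} (μ : Measure (Fin N → ℝ)) : Prop :=
  IsProbabilityMeasure μ ∧
    (p = 0 ∨ ∫⁻ x, ∑ k, ENNReal.ofReal (|x k| ^ p) ∂μ < ⊤)

/-- `T` is `p`-integrable w.r.t. `λ^N` (no condition when `p = 0`). -/
def FinLp (p : ℝ) {N : ℕ} (T : (Fin N → ℝ) → Fin N → ℝ) : Prop :=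
  p = 0 ∨ ∫⁻ u, ∑ k, ENNReal.ofReal (|T u k| ^ p) ∂(lambdaN N) < ⊤

/-- The Knothe–Rosenblatt distance `KR_p(μ,ν)` (for `p = 0` the metric
`∫ |Q^μ - Q^ν| ∧ 1 dλ^N`). -/
noncomputable def KRdist (p : ℝ) {N : ℕ} (μ ν : Measure (Fin N → ℝ)) : ℝ≥0∞ :=
  Ldist p (quantileProcess μ) (quantileProcess ν)

/-- `π` is a coupling of `μ` and `ν`. -/
def IsCoupling {α β : Type*} [MeasurableSpace α] [MeasurableSpace β]
    (π : Measure (α × β)) (μ : Measure α) (ν : Measure β) : Prop :=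
  π.map Prod.fst = μ ∧ π.map Prod.snd = ν

/-- `κ` is a disintegration (regular conditional law) of `ρ` w.r.t. its first coordinate. -/
def Disintegrates {α β : Type*} [MeasurableSpace α] [MeasurableSpace β]
    (ρ : Measure (α × β)) (κ : Kernel α β) : Prop :=
  ∀ (A : Set α) (B : Set β), MeasurableSet A → MeasurableSet B →
    ρ (A ×ˢ B) = ∫⁻ a in A, κ a B ∂(ρ.map Prod.fst)

/-- The first `k` coordinates of `x : ℝ^N`. -/
def restr {N : ℕ} (k : Fin N) (x : Fin N → ℝ) : Fin (k : ℕ) → ℝ :=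
  fun j => x ⟨j, j.isLt.trans k.isLt⟩

/-- A coupling `π` of `μ` and `ν` is bicausal if, for every `k`, the conditional law under `π`
of `(x_k, y_k)` given `(x_{1:k-1}, y_{1:k-1})` is a.s. a coupling of the conditional law of
`x_k` given `x_{1:k-1}` under `μ` and that of `y_k` given `y_{1:k-1}` under `ν`. -/
def IsBicausal {N : ℕ} (μ ν : Measure (Fin N → ℝ))
    (π : Measure ((Fin N → ℝ) × (Fin N → ℝ))) : Prop :=
  IsCoupling π μ ν ∧
  ∀ k : Fin N,
    ∃ (κ : Kernel ((Fin (k : ℕ) → ℝ) × (Fin (k : ℕ) → ℝ)) (ℝ × ℝ))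
      (κμ κν : Kernel (Fin (k : ℕ) → ℝ) ℝ),
      IsMarkovKernel κ ∧ IsMarkovKernel κμ ∧ IsMarkovKernel κν ∧
      Disintegrates (μ.map fun x => (restr k x, x k)) κμ ∧
      Disintegrates (ν.map fun y => (restr k y, y k)) κν ∧
      Disintegrates (π.map fun xy => ((restr k xy.1, restr k xy.2), (xy.1 k, xy.2 k))) κ ∧
      ∀ᵐ ab ∂(π.map fun xy => (restr k xy.1, restr k xy.2)),
        IsCoupling (κ ab) (κμ ab.1) (κν ab.2)

/-- The adapted Wasserstein distance `AW_p` (for `p = 0` with cost `|x - y| ∧ 1`). -/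
noncomputable def AWdist (p : ℝ) {N : ℕ} (μ ν : Measure (Fin N → ℝ)) : ℝ≥0∞ :=
  ⨅ (π : Measure ((Fin N → ℝ) × (Fin N → ℝ))) (_ : IsBicausal μ ν π),
    if p = 0 then ∫⁻ xy, cost0 xy.1 xy.2 ∂π
    else (∫⁻ xy, pCost p xy.1 xy.2 ∂π) ^ p⁻¹

section Cube

variable {N : ℕ}

instance lambda01_isProbabilityMeasure : IsProbabilityMeasure lambda01 :=
  ⟨by simp [lambda01]⟩

instance lambdaN_isProbabilityMeasure (N : ℕ) : IsProbabilityMeasure (lambdaN N) := by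
  unfold lambdaN; infer_instance

lemma ae_lambda01_mem_Ioo : ∀ᵐ v ∂lambda01, v ∈ Set.Ioo (0 : ℝ) 1 :=
  ae_restrict_mem measurableSet_Ioo

lemma measurableSet_cube : MeasurableSet (cube N) := by
  have : cube N = ⋂ i, (fun u : Fin N → ℝ => u i) ⁻¹' Set.Ioo 0 1 := by
    ext u; simp [cube]
  rw [this]
  exact MeasurableSet.iInter fun i => measurable_pi_apply i measurableSet_Ioo

lemma ae_mem_cube : ∀ᵐ u ∂lambdaN N, u ∈ cube N := by
  have h : ∀ i : Fin N, ∀ᵐ u ∂lambdaN N, u i ∈ Set.Ioo (0 : ℝ) 1 := fun i =>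
    (measurePreserving_eval (fun _ : Fin N => lambda01) i).quasiMeasurePreserving.ae
      ae_lambda01_mem_Ioo
  simpa [cube] using ae_all_iff.2 h

lemma update_mem_cube {u : Fin N → ℝ} (hu : u ∈ cube N) (k : Fin N) {v : ℝ}
    (hv : v ∈ Set.Ioo (0 : ℝ) 1) : Function.update u k v ∈ cube N := by
  intro i
  by_cases h : i = k
  · subst h; simpa using hv
  · simpa [h] using hu i

lemma measurable_update_pair (k : Fin N) :
    Measurable fun z : (Fin N → ℝ) × ℝ => Function.update z.1 k z.2 := by
  rw [measurable_pi_iff]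
  intro i
  by_cases h : i = k
  · subst h; simpa using measurable_snd
  · simp only [Function.update_of_ne h]
    exact (measurable_pi_apply i).comp measurable_fst

/-- Resampling one coordinate independently leaves the uniform law on the cube invariant. -/
lemma map_update_prod (k : Fin N) :
    ((lambdaN N).prod lambda01).map (fun z => Function.update z.1 k z.2) = lambdaN N := by
  refine (Measure.pi_eq fun s hs => ?_).symm
  rw [Measure.map_apply (measurable_update_pair k) (MeasurableSet.univ_pi hs)]
  have : (fun z : (Fin N → ℝ) × ℝ => Function.update z.1 k z.2) ⁻¹' Set.univ.pi s
      = (Set.univ.pi (Function.update s k Set.univ)) ×ˢ s k := by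
    ext ⟨u, v⟩
    simp only [mem_preimage, Set.mem_pi, Set.mem_univ, true_imp_iff, Set.mem_prod]
    constructor
    · intro h
      refine ⟨fun i => ?_, by simpa using h k⟩
      by_cases hi : i = k
      · subst hi; simp
      · simpa [hi] using h i
    · rintro ⟨h, hk⟩ i
      by_cases hi : i = k
      · subst hi; simpa using hk
      · simpa [hi] using h i
  rw [this, Measure.prod_prod, lambdaN, Measure.pi_pi,
    ← Finset.prod_erase_mul _ _ (Finset.mem_univ k),
    ← Finset.prod_erase_mul Finset.univ (fun i => lambda01 (s i)) (Finset.mem_univ k)]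
  simp only [Function.update_self, measure_univ, mul_one]
  congr 1
  refine Finset.prod_congr rfl fun i hi => ?_
  rw [Function.update_of_ne (Finset.ne_of_mem_erase hi)]

lemma lambdaN_apply_update (k : Fin N) {S : Set (Fin N → ℝ)} (hS : MeasurableSet S) :
    lambdaN N S = ∫⁻ u, lambda01 {v | Function.update u k v ∈ S} ∂lambdaN N := by
  conv_lhs => rw [← map_update_prod k]
  rw [Measure.map_apply (measurable_update_pair k) hS,
    Measure.prod_apply (measurable_update_pair k hS)]
  rfl

end Cube

section Disintegration

variable {N : ℕ}

lemma Disintegrates.eq_compProd {α β : Type*} [MeasurableSpace α] [MeasurableSpace β]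
    {ρ : Measure (α × β)} [IsFiniteMeasure ρ] {κ : Kernel α β} [IsMarkovKernel κ]
    (h : Disintegrates ρ κ) : (ρ.map Prod.fst) ⊗ₘ κ = ρ := by
  refine Measure.ext_prod fun {A B} hA hB => ?_
  rw [Measure.compProd_apply_prod hA hB, h A B hA hB]

lemma disintegrates_condDistrib {Ω α β : Type*} [MeasurableSpace Ω] [MeasurableSpace α]
    [MeasurableSpace β] [StandardBorelSpace β] [Nonempty β] {P : Measure Ω} [IsFiniteMeasure P]
    {T : Ω → α} {X : Ω → β} (hT : Measurable T) (hX : Measurable X) :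
    Disintegrates (P.map fun ω => (T ω, X ω)) (condDistrib X T P) := by
  intro A B hA hB
  rw [Measure.map_map measurable_fst (hT.prodMk hX)]
  change _ = ∫⁻ a in A, _ ∂(P.map T)
  rw [← compProd_map_condDistrib hX.aemeasurable, Measure.compProd_apply_prod hA hB]

/-- Two random variables with equal integrals over all `T`-measurable events, both constant on the
fibres of `T` over a conull Borel set, agree almost everywhere. -/
lemma ae_eq_of_fiberwise {Ω E : Type*} [MeasurableSpace Ω] [StandardBorelSpace Ω]
    [MeasurableSpace E] [StandardBorelSpace E] {P : Measure Ω}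
    {T : Ω → E} (hT : Measurable T) {C : Set Ω} (hC : MeasurableSet C) (hPC : ∀ᵐ u ∂P, u ∈ C)
    {f g : Ω → ℝ≥0∞} (hf : Measurable f) (hg : Measurable g)
    (hfT : ∀ u ∈ C, ∀ w ∈ C, T u = T w → f u = f w)
    (hgT : ∀ u ∈ C, ∀ w ∈ C, T u = T w → g u = g w)
    (hfin : ∫⁻ u, f u ∂P ≠ ∞)
    (h : ∀ A, MeasurableSet A → ∫⁻ u in T ⁻¹' A, f u ∂P = ∫⁻ u in T ⁻¹' A, g u ∂P) :
    f =ᵐ[P] g := by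
  have key : ∀ S : Set Ω, MeasurableSet S → (∀ u ∈ C, ∀ w ∈ C, T u = T w → (u ∈ S ↔ w ∈ S)) →
      ∫⁻ u in S, f u ∂P = ∫⁻ u in S, g u ∂P := by
    intro S hS hST
    let := upgradeStandardBorel E
    have h1 : AnalyticSet (T '' (S ∩ C)) := (hS.inter hC).analyticSet_image hT
    have h2 : AnalyticSet (T '' (Sᶜ ∩ C)) := (hS.compl.inter hC).analyticSet_image hT
    obtain ⟨B, hB1, hB2, hB⟩ := h1.measurablySeparable h2 (by
      rw [Set.disjoint_left]
      rintro _ ⟨u, ⟨huS, huC⟩, rfl⟩ ⟨w, ⟨hwS, hwC⟩, hw⟩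
      exact hwS ((hST w hwC u huC hw).2 huS))
    have hSB : S =ᵐ[P] T ⁻¹' B := by
      filter_upwards [hPC] with u hu
      apply propext
      change u ∈ S ↔ T u ∈ B
      constructor
      · intro huS
        exact hB1 ⟨u, ⟨huS, hu⟩, rfl⟩
      · intro huB
        by_contra huS
        exact Set.disjoint_left.1 hB2 ⟨u, ⟨huS, hu⟩, rfl⟩ huB
    rw [setLIntegral_congr hSB, setLIntegral_congr hSB, h B hB]
  have hlt : ∀ f' g' : Ω → ℝ≥0∞, Measurable f' → Measurable g' →
      ∫⁻ u in {u | g' u < f' u}, g' u ∂P ≠ ∞ →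
      ∫⁻ u in {u | g' u < f' u}, f' u ∂P ≤ ∫⁻ u in {u | g' u < f' u}, g' u ∂P →
      f' ≤ᵐ[P] g' := by
    intro f' g' hf' hg' hne hle
    have hS : MeasurableSet {u | g' u < f' u} := measurableSet_lt hg' hf'
    have hae := ae_eq_of_ae_le_of_lintegral_le
      (((ae_restrict_mem hS).mono fun u hu => le_of_lt hu)) hne hf'.aemeasurable hle
    rw [EventuallyEq, ae_restrict_iff' hS] at hae
    filter_upwards [hae] with u hu
    by_contra hcon
    have hlt := not_le.1 hcon
    exact absurd (hu hlt) hlt.ne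
  have hfin' : ∀ S : Set Ω, ∫⁻ u in S, f u ∂P ≠ ∞ := fun S =>
    ne_top_of_le_ne_top hfin (setLIntegral_le_lintegral _ _)
  have e1 := key {u | g u < f u} (measurableSet_lt hg hf) (by
    intro u hu w hw huw
    simp [hfT u hu w hw huw, hgT u hu w hw huw])
  have e2 := key {u | f u < g u} (measurableSet_lt hf hg) (by
    intro u hu w hw huw
    simp [hfT u hu w hw huw, hgT u hu w hw huw])
  filter_upwards [hlt f g hf hg (e1 ▸ hfin' _) e1.le, hlt g f hg hf (hfin' _) e2.ge] with u h1 h2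
  exact le_antisymm h1 h2

/-- If `T` ignores the `k`-th coordinate and determines the law of `X` under resampling of the
`k`-th coordinate, then that law is the conditional law of `X` given `T`. -/
lemma condLaw_apply (k : Fin N) {E F : Type*} [MeasurableSpace E] [StandardBorelSpace E]
    [MeasurableSpace F] {T : (Fin N → ℝ) → E} {X : (Fin N → ℝ) → F}
    (hT : Measurable T) (hX : Measurable X)
    (hTk : ∀ u v, T (Function.update u k v) = T u)
    (hfib : ∀ u ∈ cube N, ∀ w ∈ cube N, T u = T w → ∀ v ∈ Set.Ioo (0 : ℝ) 1,
      X (Function.update u k v) = X (Function.update w k v))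
    {κ : Kernel E F} [IsMarkovKernel κ]
    (hκ : Disintegrates ((lambdaN N).map fun u => (T u, X u)) κ) {B : Set F}
    (hB : MeasurableSet B) :
    ∀ᵐ u ∂lambdaN N, κ (T u) B = lambda01 {v | X (Function.update u k v) ∈ B} := by
  have hm : Measurable fun u : Fin N → ℝ => lambda01 {v | X (Function.update u k v) ∈ B} :=
    measurable_measure_prodMk_left ((hX.comp (measurable_update_pair k)) hB)
  refine ae_eq_of_fiberwise hT measurableSet_cube ae_mem_cube
    ((κ.measurable_coe hB).comp hT) hm ?_ ?_ ?_ ?_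
  · intro u _ w _ h
    simp [h]
  · intro u hu w hw h
    refine measure_congr ?_
    filter_upwards [ae_lambda01_mem_Ioo] with v hv
    apply propext
    change X _ ∈ B ↔ X _ ∈ B
    rw [hfib u hu w hw h v hv]
  · refine ne_top_of_le_ne_top ENNReal.one_ne_top ?_
    calc ∫⁻ u, κ (T u) B ∂lambdaN N ≤ ∫⁻ _, 1 ∂lambdaN N := lintegral_mono fun u => prob_le_one
      _ = 1 := by simp
  · intro A hA
    have h1 := hκ A B hA hB
    rw [Measure.map_map measurable_fst (hT.prodMk hX)] at h1
    change _ = ∫⁻ a in A, _ ∂((lambdaN N).map T) at h1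
    rw [setLIntegral_map hA (κ.measurable_coe hB) hT] at h1
    rw [← h1, Measure.map_apply (hT.prodMk hX) (hA.prod hB),
      lambdaN_apply_update k ((hT.prodMk hX) (hA.prod hB)), ← lintegral_indicator (hT hA)]
    refine lintegral_congr fun u => ?_
    by_cases hu : T u ∈ A <;> simp [Set.indicator, hTk, hu]

lemma Real.measure_eq_of_Iic_rat {m m' : Measure ℝ} [IsProbabilityMeasure m]
    [IsProbabilityMeasure m'] (h : ∀ q : ℚ, m (Set.Iic (q : ℝ)) = m' (Set.Iic (q : ℝ))) :
    m = m' := by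
  refine ext_of_generate_finite _ (BorelSpace.measurable_eq.trans
    Real.borel_eq_generateFrom_Iic_rat) Real.isPiSystem_Iic_rat ?_ (by simp)
  intro s hs
  simp only [Set.mem_iUnion, Set.mem_singleton_iff] at hs
  obtain ⟨q, rfl⟩ := hs
  exact h q

lemma condLaw_eq_map (k : Fin N) {E : Type*} [MeasurableSpace E] [StandardBorelSpace E]
    {T : (Fin N → ℝ) → E} {X : (Fin N → ℝ) → ℝ}
    (hT : Measurable T) (hX : Measurable X)
    (hTk : ∀ u v, T (Function.update u k v) = T u)
    (hfib : ∀ u ∈ cube N, ∀ w ∈ cube N, T u = T w → ∀ v ∈ Set.Ioo (0 : ℝ) 1,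
      X (Function.update u k v) = X (Function.update w k v))
    {κ : Kernel E ℝ} [IsMarkovKernel κ]
    (hκ : Disintegrates ((lambdaN N).map fun u => (T u, X u)) κ) :
    ∀ᵐ u ∂lambdaN N, κ (T u) = lambda01.map fun v => X (Function.update u k v) := by
  have h := ae_all_iff.2 fun q : ℚ =>
    condLaw_apply k hT hX hTk hfib hκ (measurableSet_Iic (a := (q : ℝ)))
  filter_upwards [h] with u hu
  have hXu : Measurable fun v => X (Function.update u k v) :=
    hX.comp ((measurable_update_pair k).comp measurable_prodMk_left)
  have := Measure.isProbabilityMeasure_map hXu.aemeasurable (μ := lambda01)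
  refine Real.measure_eq_of_Iic_rat fun q => ?_
  rw [hu q, Measure.map_apply hXu measurableSet_Iic]
  rfl

end Disintegration

section Existence

/-- The left-continuous quantile function of a probability measure on the line, extended by zero
outside `(0,1)`. -/
noncomputable def quantileFun (m : Measure ℝ) (v : ℝ) : ℝ :=
  open Classical in if v ∈ Set.Ioo (0 : ℝ) 1 then sInf {x | v ≤ cdf m x} else 0

lemma quantileFun_le_iff (m : Measure ℝ) {v : ℝ} (hv : v ∈ Set.Ioo (0 : ℝ) 1)
    (x : ℝ) : quantileFun m v ≤ x ↔ v ≤ cdf m x := by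
  have hne : {x | v ≤ cdf m x}.Nonempty := by
    obtain ⟨y, hy⟩ := ((tendsto_cdf_atTop m).eventually (lt_mem_nhds hv.2)).exists
    exact ⟨y, le_of_lt hy⟩
  have hbdd : BddBelow {x | v ≤ cdf m x} := by
    obtain ⟨y, hy⟩ := ((tendsto_cdf_atBot m).eventually (gt_mem_nhds hv.1)).exists
    refine ⟨y, fun x hx => ?_⟩
    by_contra hxy
    exact absurd (lt_of_le_of_lt (monotone_cdf m (not_le.1 hxy).le) hy) (not_lt.2 hx)
  rw [quantileFun, if_pos hv]
  constructor
  · intro h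
    have hright : Tendsto (cdf m) (𝓝[>] x) (𝓝 (cdf m x)) :=
      ((cdf m).right_continuous x).mono_left (nhdsWithin_mono _ Set.Ioi_subset_Ici_self)
    refine ge_of_tendsto hright ?_
    filter_upwards [self_mem_nhdsWithin] with y hy
    obtain ⟨z, hz, hzy⟩ := exists_lt_of_csInf_lt hne (lt_of_le_of_lt h hy)
    exact le_trans hz (monotone_cdf m hzy.le)
  · intro h
    exact csInf_le hbdd h

lemma quantileFun_mono (m : Measure ℝ) {v w : ℝ} (hv : v ∈ Set.Ioo (0 : ℝ) 1)
    (hw : w ∈ Set.Ioo (0 : ℝ) 1) (h : v ≤ w) : quantileFun m v ≤ quantileFun m w :=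
  (quantileFun_le_iff m hv _).2 (h.trans ((quantileFun_le_iff m hw _).1 le_rfl))

lemma measurable_quantileFun_kernel {α : Type*} [MeasurableSpace α] (κ : Kernel α ℝ)
    [IsMarkovKernel κ] : Measurable fun z : α × ℝ => quantileFun (κ z.1) z.2 := by
  refine measurable_of_Iic fun x => ?_
  have : (fun z : α × ℝ => quantileFun (κ z.1) z.2) ⁻¹' Set.Iic x =
      {z | z.2 ∈ Set.Ioo (0 : ℝ) 1 ∧ z.2 ≤ (κ z.1).real (Set.Iic x)} ∪
        {z | ¬ z.2 ∈ Set.Ioo (0 : ℝ) 1 ∧ 0 ≤ x} := by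
    ext z
    by_cases hz : z.2 ∈ Set.Ioo (0 : ℝ) 1
    · simp only [mem_preimage, Set.mem_Iic, quantileFun_le_iff _ hz, cdf_eq_real]
      simp [hz.1, hz.2]
    · simp only [mem_preimage, Set.mem_Iic, quantileFun, if_neg hz]
      simp only [Set.mem_union, Set.mem_ofPred_eq, hz, false_and, not_false_eq_true, true_and,
        false_or]
  rw [this]
  have hIoo : MeasurableSet {z : α × ℝ | z.2 ∈ Set.Ioo (0 : ℝ) 1} :=
    measurable_snd measurableSet_Ioo
  have hκ : Measurable fun z : α × ℝ => (κ z.1).real (Set.Iic x) :=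
    ((κ.measurable_coe measurableSet_Iic).comp measurable_fst).ennreal_toReal
  exact (hIoo.inter (measurableSet_le measurable_snd hκ)).union
    (hIoo.compl.inter (MeasurableSet.const _))

lemma measurable_quantileFun (m : Measure ℝ) [IsProbabilityMeasure m] :
    Measurable (quantileFun m) :=
  (measurable_quantileFun_kernel (Kernel.const Unit m)).comp
    (measurable_prodMk_left (x := ()))

lemma map_quantileFun (m : Measure ℝ) [IsProbabilityMeasure m] :
    lambda01.map (quantileFun m) = m := by
  have := Measure.isProbabilityMeasure_map (measurable_quantileFun m).aemeasurable (μ := lambda01)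
  refine Real.measure_eq_of_Iic_rat fun q => ?_
  rw [Measure.map_apply (measurable_quantileFun m) measurableSet_Iic, lambda01,
    Measure.restrict_apply (measurable_quantileFun m measurableSet_Iic)]
  have h0 := cdf_nonneg m q
  have h1 := cdf_le_one m q
  have hset : (quantileFun m ⁻¹' Set.Iic (q : ℝ) ∩ Set.Ioo 0 1 : Set ℝ)
      = Set.Ioo 0 1 ∩ Set.Iic (cdf m q) := by
    ext v
    constructor
    · rintro ⟨hv, hv'⟩
      exact ⟨hv', (quantileFun_le_iff m hv' _).1 hv⟩
    · rintro ⟨hv', hv⟩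
      exact ⟨(quantileFun_le_iff m hv' _).2 hv, hv'⟩
  have hvol : volume (Set.Ioo (0 : ℝ) 1 ∩ Set.Iic (cdf m q)) = ENNReal.ofReal (cdf m q) := by
    have hae : (Set.Ioo (0 : ℝ) 1 ∩ Set.Iic (cdf m q) : Set ℝ) =ᵐ[volume]
        (Set.Ioc (0 : ℝ) 1 ∩ Set.Iic (cdf m q) : Set ℝ) :=
      Ioo_ae_eq_Ioc.inter (ae_eq_refl _)
    rw [measure_congr hae, Set.Ioc_inter_Iic, min_eq_right h1, Real.volume_Ioc, sub_zero]
  rw [hset, hvol, ofReal_cdf]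

variable {N : ℕ}

/-- The triangular map whose `k`-th coordinate is the quantile, at the level `u k`, of the
`k`-th transition kernel evaluated at the already constructed coordinates. -/
noncomputable def quantileRec (κ : ∀ k : Fin N, Kernel (Fin (k : ℕ) → ℝ) ℝ) (u : Fin N → ℝ) :
    Fin N → ℝ
  | k => quantileFun (κ k fun j => quantileRec κ u ⟨j, j.isLt.trans k.isLt⟩) (u k)
termination_by k => k.val
decreasing_by exact j.isLt

lemma quantileRec_apply (κ : ∀ k : Fin N, Kernel (Fin (k : ℕ) → ℝ) ℝ) (u : Fin N → ℝ)
    (k : Fin N) :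
    quantileRec κ u k = quantileFun (κ k (restr k (quantileRec κ u))) (u k) := by
  rw [quantileRec]
  rfl

lemma restr_eq_of_forall_lt {k : Fin N} {x y : Fin N → ℝ} (h : ∀ j < k, x j = y j) :
    restr k x = restr k y :=
  funext fun j => h ⟨j, j.isLt.trans k.isLt⟩ j.isLt

lemma eq_of_restr_eq {k : Fin N} {x y : Fin N → ℝ} (h : restr k x = restr k y) {j : Fin N}
    (hj : j < k) : x j = y j :=
  congrFun h ⟨j, hj⟩

lemma measurable_restr (k : Fin N) : Measurable (restr k) :=
  measurable_pi_lambda _ fun _ => measurable_pi_apply _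

lemma measurable_quantileRec (κ : ∀ k : Fin N, Kernel (Fin (k : ℕ) → ℝ) ℝ)
    [∀ k, IsMarkovKernel (κ k)] : Measurable (quantileRec κ) := by
  rw [measurable_pi_iff]
  intro k
  induction k using WellFoundedLT.induction with
  | ind k ih =>
    simp_rw [quantileRec_apply κ _ k]
    refine (measurable_quantileFun_kernel (κ k)).comp (Measurable.prodMk ?_ (measurable_pi_apply k))
    exact measurable_pi_lambda _ fun j => ih ⟨j, j.isLt.trans k.isLt⟩ j.isLt

lemma isQuantileProcess_quantileRec (κ : ∀ k : Fin N, Kernel (Fin (k : ℕ) → ℝ) ℝ)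
    [∀ k, IsMarkovKernel (κ k)] : IsQuantileProcess (quantileRec κ) := by
  have htri : Triangular (quantileRec κ) := by
    intro k u v
    induction k using WellFoundedLT.induction with
    | ind k ih =>
      intro h
      rw [quantileRec_apply κ u, quantileRec_apply κ v, h k le_rfl,
        restr_eq_of_forall_lt fun j hj => ih j hj fun i hi => h i (hi.trans hj.le)]
  refine ⟨measurable_quantileRec κ, htri, ?_, ?_⟩
  · intro k u hu v hv h hk
    rw [quantileRec_apply κ u, quantileRec_apply κ v,
      restr_eq_of_forall_lt fun j hj => htri j u v fun i hi => h i (hi.trans_lt hj)]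
    exact quantileFun_mono _ (hu k) (hv k) hk
  · intro k m hkm u hu v hv h hk
    induction m using WellFoundedLT.induction with
    | ind m ih =>
      rcases hkm.eq_or_lt with rfl | hlt
      · exact hk
      rw [quantileRec_apply κ u, quantileRec_apply κ v, h m hlt.ne']
      congr 2
      refine restr_eq_of_forall_lt fun j hj => ?_
      rcases le_or_gt k j with hkj | hjk
      · exact ih j hj hkj
      · exact htri j u v fun i hi => h i (hi.trans_lt hjk).ne

lemma restr_comp_update {Q : (Fin N → ℝ) → Fin N → ℝ} (hQ : Triangular Q) (k : Fin N)
    (u : Fin N → ℝ) (v : ℝ) : restr k (Q (Function.update u k v)) = restr k (Q u) :=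
  restr_eq_of_forall_lt fun j hj => hQ j _ _ fun _ hi =>
    Function.update_of_ne (hi.trans_lt hj).ne _ _

lemma map_quantileRec (μ : Measure (Fin N → ℝ)) [IsProbabilityMeasure μ]
    (κ : ∀ k : Fin N, Kernel (Fin (k : ℕ) → ℝ) ℝ) [∀ k, IsMarkovKernel (κ k)]
    (hκ : ∀ k, Disintegrates (μ.map fun x => (restr k x, x k)) (κ k)) :
    (lambdaN N).map (quantileRec κ) = μ := by
  have hQ := isQuantileProcess_quantileRec κ
  set Q := quantileRec κ with hQdef
  let trunc : ℕ → (Fin N → ℝ) → Fin N → ℝ := fun n x j => if (j : ℕ) < n then x j else 0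
  have htrunc : ∀ n, Measurable (trunc n) := fun n => by
    refine measurable_pi_lambda _ fun j => ?_
    by_cases h : (j : ℕ) < n
    · simpa [trunc, h] using measurable_pi_apply j
    · simp [trunc, h]
  have main : ∀ n ≤ N, (lambdaN N).map (fun u => trunc n (Q u)) = μ.map (trunc n) := by
    intro n
    induction n with
    | zero => intro _; simp [trunc]
    | succ n ih =>
      intro hn
      let k : Fin N := ⟨n, hn⟩
      let glue : (Fin (k : ℕ) → ℝ) × ℝ → Fin N → ℝ := fun z j =>
        if h : (j : ℕ) < n then z.1 ⟨j, h⟩ else if j = k then z.2 else 0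
      have hpair : ∀ x, trunc (n + 1) x = glue (restr k x, x k) := by
        intro x
        funext j
        by_cases h : (j : ℕ) < n
        · simp [trunc, glue, h, restr, Nat.lt_succ_of_lt h]
        · by_cases h' : j = k
          · subst h'; simp [trunc, glue, k]
          · have : ¬ (j : ℕ) < n + 1 := fun hlt =>
              h' (Fin.ext (le_antisymm (Nat.lt_succ_iff.1 hlt) (not_lt.1 h)))
            simp [trunc, glue, h, h', this]
      have hglue : Measurable glue := by
        refine measurable_pi_lambda _ fun j => ?_
        by_cases h : (j : ℕ) < n
        · simp only [glue, h, dite_true]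
          exact (measurable_pi_apply _).comp measurable_fst
        · by_cases h' : j = k
          · have : (fun z : (Fin (k : ℕ) → ℝ) × ℝ => glue z j) = Prod.snd := by
              funext z; simp only [glue, dif_neg h, if_pos h']
            rw [this]
            exact measurable_snd
          · simp [glue, h, h']
      have hres : ∀ x, restr k x = restr k (trunc n x) := fun x =>
        restr_eq_of_forall_lt fun j hj => by
          have : (j : ℕ) < n := hj
          simp [trunc, this]
      have hmp : Measurable fun x : Fin N → ℝ => (restr k x, x k) :=
        (measurable_restr k).prodMk (measurable_pi_apply k)
      have hmpQ : Measurable fun u => (restr k (Q u), Q u k) := hmp.comp hQ.measurable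
      have hmarg : (lambdaN N).map (fun u => restr k (Q u)) = μ.map (restr k) := by
        have h1 : (fun u => restr k (Q u)) = restr k ∘ fun u => trunc n (Q u) :=
          funext fun u => hres _
        have h2 : (restr k : (Fin N → ℝ) → _) = restr k ∘ trunc n := funext hres
        have hm : Measurable fun u => trunc n (Q u) := (htrunc n).comp hQ.measurable
        rw [h1, ← Measure.map_map (measurable_restr k) hm, ih (Nat.le_of_succ_le hn),
          Measure.map_map (measurable_restr k) (htrunc n), ← h2]
      have hjoint : (lambdaN N).map (fun u => (restr k (Q u), Q u k)) =
          μ.map fun x => (restr k x, x k) := by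
        refine Measure.ext_prod fun {A B} hA hB => ?_
        have hTm : Measurable fun u => restr k (Q u) := (measurable_restr k).comp hQ.measurable
        rw [hκ k A B hA hB, Measure.map_map measurable_fst hmp]
        change _ = ∫⁻ a in A, _ ∂(μ.map (restr k))
        rw [← hmarg, setLIntegral_map hA ((κ k).measurable_coe hB) hTm,
          Measure.map_apply hmpQ (hA.prod hB),
          lambdaN_apply_update k (hmpQ (hA.prod hB)),
          ← lintegral_indicator (hTm hA)]
        refine lintegral_congr fun u => ?_
        have hk : ∀ v, Q (Function.update u k v) k = quantileFun (κ k (restr k (Q u))) v := by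
          intro v
          rw [hQdef, quantileRec_apply, ← hQdef, restr_comp_update hQ.triangular]
          simp
        by_cases hu : restr k (Q u) ∈ A
        · simp only [Set.indicator, mem_preimage, hu, if_true, Set.mem_prod,
            restr_comp_update hQ.triangular, true_and, hk]
          conv_rhs => rw [← map_quantileFun (κ k (restr k (Q u)))]
          rw [Measure.map_apply (measurable_quantileFun _) hB]
          rfl
        · simp [Set.indicator, hu, restr_comp_update hQ.triangular]
      have e1 : (fun u => trunc (n + 1) (Q u)) = glue ∘ fun u => (restr k (Q u), Q u k) :=
        funext fun u => hpair (Q u)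
      have e2 : trunc (n + 1) = glue ∘ fun x => (restr k x, x k) := funext hpair
      rw [e1, e2, ← Measure.map_map hglue hmpQ, ← Measure.map_map hglue hmp, hjoint]
  have hid : trunc N = id := by
    funext x j
    simp [trunc, j.isLt]
  simpa [hid] using main N le_rfl

lemma exists_isQuantileProcess (μ : Measure (Fin N → ℝ)) [IsProbabilityMeasure μ] :
    ∃ Q, IsQuantileProcess Q ∧ (lambdaN N).map Q = μ :=
  ⟨quantileRec fun k => condDistrib (fun x => x k) (restr k) μ, isQuantileProcess_quantileRec _,
    map_quantileRec μ _ fun k =>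
      disintegrates_condDistrib (measurable_restr k) (measurable_pi_apply k)⟩

lemma quantileProcess_spec (μ : Measure (Fin N → ℝ)) [IsProbabilityMeasure μ] :
    IsQuantileProcess (quantileProcess μ) ∧ (lambdaN N).map (quantileProcess μ) = μ :=
  Classical.epsilon_spec (exists_isQuantileProcess μ)

end Existence

section Bicausal

variable {N : ℕ}

lemma IsQuantileProcess.apply_eq_of_restr_eq {Q : (Fin N → ℝ) → Fin N → ℝ}
    (hQ : IsQuantileProcess Q) (k : Fin N) {u w : Fin N → ℝ} (hu : u ∈ cube N) (hw : w ∈ cube N)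
    (h : restr k (Q u) = restr k (Q w)) (hk : u k = w k) : Q u k = Q w k := by
  let z : ℕ → Fin N → ℝ := fun n j => if (j : ℕ) < n then w j else u j
  have hz : ∀ n, z n ∈ cube N := fun n i => by
    by_cases hi : (i : ℕ) < n
    · simpa [z, hi] using hw i
    · simpa [z, hi] using hu i
  have main : ∀ n ≤ (k : ℕ), ∀ j : Fin N, n ≤ j → Q (z n) j = Q u j := by
    intro n
    induction n with
    | zero => intro _ j _; simp [z]
    | succ n ih =>
      intro hn j hj
      let i : Fin N := ⟨n, (Nat.lt_of_succ_le hn).trans k.isLt⟩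
      have hik : i < k := Nat.lt_of_succ_le hn
      have hij : i ≤ j := Nat.le_of_succ_le hj
      rw [← ih (Nat.le_of_succ_le hn) j hij]
      refine hQ.con i j hij _ (hz _) _ (hz _) ?_ ?_
      · intro l hl
        have hl' : (l : ℕ) ≠ n := fun e => hl (Fin.ext e)
        have : (l : ℕ) < n + 1 ↔ (l : ℕ) < n := by omega
        simp [z, this]
      · rw [ih (Nat.le_of_succ_le hn) i le_rfl, eq_of_restr_eq h hik]
        refine hQ.triangular i _ _ fun l hl => ?_
        have : (l : ℕ) < n + 1 := Nat.lt_succ_of_le hl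
        simp [z, this]
  rw [← main k le_rfl k le_rfl]
  refine hQ.triangular k _ _ fun l hl => ?_
  rcases hl.eq_or_lt with rfl | hlt
  · simpa [z] using hk
  · have : (l : ℕ) < k := hlt
    simp [z, this]

lemma IsQuantileProcess.update_eq_of_restr_eq {Q : (Fin N → ℝ) → Fin N → ℝ}
    (hQ : IsQuantileProcess Q) (k : Fin N) {u w : Fin N → ℝ} (hu : u ∈ cube N) (hw : w ∈ cube N)
    (h : restr k (Q u) = restr k (Q w)) {v : ℝ} (hv : v ∈ Set.Ioo (0 : ℝ) 1) :
    Q (Function.update u k v) k = Q (Function.update w k v) k :=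
  hQ.apply_eq_of_restr_eq k (update_mem_cube hu k hv) (update_mem_cube hw k hv)
    (by rw [restr_comp_update hQ.triangular, restr_comp_update hQ.triangular, h]) (by simp)

lemma measurable_restr_apply (k : Fin N) :
    Measurable fun x : Fin N → ℝ => (restr k x, x k) :=
  (measurable_restr k).prodMk (measurable_pi_apply k)

lemma measurable_restr_prod (k : Fin N) :
    Measurable fun xy : (Fin N → ℝ) × (Fin N → ℝ) => (restr k xy.1, restr k xy.2) :=
  ((measurable_restr k).comp measurable_fst).prodMk ((measurable_restr k).comp measurable_snd)

lemma measurable_apply_prod (k : Fin N) :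
    Measurable fun xy : (Fin N → ℝ) × (Fin N → ℝ) => (xy.1 k, xy.2 k) :=
  ((measurable_pi_apply k).comp measurable_fst).prodMk
    ((measurable_pi_apply k).comp measurable_snd)

/-- Any version of the `k`-th transition kernel of `μ`, evaluated along a quantile process of `μ`,
is the law of the `k`-th component when the `k`-th coordinate is resampled. -/
lemma IsQuantileProcess.kernel_eq_map {Q : (Fin N → ℝ) → Fin N → ℝ} (hQ : IsQuantileProcess Q)
    {μ : Measure (Fin N → ℝ)} (hμ : (lambdaN N).map Q = μ) (k : Fin N)
    {κ : Kernel (Fin (k : ℕ) → ℝ) ℝ} [IsMarkovKernel κ]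
    (hκ : Disintegrates (μ.map fun x => (restr k x, x k)) κ) :
    ∀ᵐ u ∂lambdaN N, κ (restr k (Q u)) =
      lambda01.map fun v => Q (Function.update u k v) k := by
  rw [← hμ, Measure.map_map (measurable_restr_apply k) hQ.measurable] at hκ
  exact condLaw_eq_map k ((measurable_restr k).comp hQ.measurable)
    ((measurable_pi_apply k).comp hQ.measurable) (restr_comp_update hQ.triangular k)
    (fun u hu w hw h v hv => hQ.update_eq_of_restr_eq k hu hw h hv) hκ

/-- The Knothe–Rosenblatt coupling is bicausal. -/
lemma isBicausal_map_prodMk {μ ν : Measure (Fin N → ℝ)} {Q R : (Fin N → ℝ) → Fin N → ℝ}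
    (hQ : IsQuantileProcess Q) (hQμ : (lambdaN N).map Q = μ)
    (hR : IsQuantileProcess R) (hRν : (lambdaN N).map R = ν) :
    IsBicausal μ ν ((lambdaN N).map fun u => (Q u, R u)) := by
  have hm : Measurable fun u => (Q u, R u) := hQ.measurable.prodMk hR.measurable
  have : IsProbabilityMeasure μ := hQμ ▸ Measure.isProbabilityMeasure_map hQ.measurable.aemeasurable
  have : IsProbabilityMeasure ν := hRν ▸ Measure.isProbabilityMeasure_map hR.measurable.aemeasurable
  have : IsProbabilityMeasure ((lambdaN N).map fun u => (Q u, R u)) :=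
    Measure.isProbabilityMeasure_map hm.aemeasurable
  refine ⟨⟨?_, ?_⟩, fun k => ?_⟩
  · rw [Measure.map_map measurable_fst hm]; exact hQμ
  · rw [Measure.map_map measurable_snd hm]; exact hRν
  set π := (lambdaN N).map fun u => (Q u, R u) with hπ
  have hT := measurable_restr_prod k
  have hX := measurable_apply_prod k
  have hκ := disintegrates_condDistrib (P := π) hT hX
  have hκμ := disintegrates_condDistrib (P := μ) (measurable_restr k) (measurable_pi_apply k)
  have hκν := disintegrates_condDistrib (P := ν) (measurable_restr k) (measurable_pi_apply k)
  refine ⟨_, _, _, inferInstance, inferInstance, inferInstance, hκμ, hκν, hκ, ?_⟩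
  set κ := condDistrib (fun xy : (Fin N → ℝ) × (Fin N → ℝ) => (xy.1 k, xy.2 k))
    (fun xy => (restr k xy.1, restr k xy.2)) π
  set κμ := condDistrib (fun x : Fin N → ℝ => x k) (restr k) μ
  set κν := condDistrib (fun x : Fin N → ℝ => x k) (restr k) ν
  have hκ' := hκ
  rw [hπ, Measure.map_map (hT.prodMk hX) hm] at hκ'
  have hjoint : ∀ B : Set (ℝ × ℝ), MeasurableSet B → ∀ᵐ u ∂lambdaN N,
      κ (restr k (Q u), restr k (R u)) B =
        lambda01 {v | (Q (Function.update u k v) k, R (Function.update u k v) k) ∈ B} := by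
    intro B hB
    refine condLaw_apply k (hT.comp hm) (hX.comp hm) ?_ ?_ hκ' hB
    · intro u v
      simp [restr_comp_update hQ.triangular, restr_comp_update hR.triangular]
    · intro u hu w hw h v hv
      obtain ⟨h1, h2⟩ := Prod.ext_iff.1 h
      exact Prod.ext (hQ.update_eq_of_restr_eq k hu hw h1 hv)
        (hR.update_eq_of_restr_eq k hu hw h2 hv)
  have hQm : ∀ u, Measurable fun v => Q (Function.update u k v) k := fun u =>
    ((measurable_pi_apply k).comp hQ.measurable).comp
      ((measurable_update_pair k).comp measurable_prodMk_left)
  have hRm : ∀ u, Measurable fun v => R (Function.update u k v) k := fun u =>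
    ((measurable_pi_apply k).comp hR.measurable).comp
      ((measurable_update_pair k).comp measurable_prodMk_left)
  have hq : ∀ q : ℚ, ∀ᵐ ab ∂(π.map fun xy => (restr k xy.1, restr k xy.2)),
      κ ab (Prod.fst ⁻¹' Set.Iic (q : ℝ)) = κμ ab.1 (Set.Iic (q : ℝ)) ∧
      κ ab (Prod.snd ⁻¹' Set.Iic (q : ℝ)) = κν ab.2 (Set.Iic (q : ℝ)) := by
    intro q
    have hq := measurableSet_Iic (a := (q : ℝ))
    have m1 : MeasurableSet (Prod.fst ⁻¹' Set.Iic (q : ℝ) : Set (ℝ × ℝ)) := measurable_fst hq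
    have m2 : MeasurableSet (Prod.snd ⁻¹' Set.Iic (q : ℝ) : Set (ℝ × ℝ)) := measurable_snd hq
    have hset : MeasurableSet {ab : (Fin (k : ℕ) → ℝ) × (Fin (k : ℕ) → ℝ) |
        κ ab (Prod.fst ⁻¹' Set.Iic (q : ℝ)) = κμ ab.1 (Set.Iic (q : ℝ)) ∧
        κ ab (Prod.snd ⁻¹' Set.Iic (q : ℝ)) = κν ab.2 (Set.Iic (q : ℝ))} :=
      (measurableSet_eq_fun (κ.measurable_coe m1)
          ((κμ.measurable_coe hq).comp measurable_fst)).inter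
        (measurableSet_eq_fun (κ.measurable_coe m2)
          ((κν.measurable_coe hq).comp measurable_snd))
    rw [hπ, Measure.map_map hT hm, ae_map_iff (hT.comp hm).aemeasurable hset]
    filter_upwards [hjoint _ m1, hjoint _ m2, hQ.kernel_eq_map hQμ k hκμ,
      hR.kernel_eq_map hRν k hκν] with u h1 h2 h3 h4
    refine ⟨?_, ?_⟩
    · change κ (restr k (Q u), restr k (R u)) _ = κμ (restr k (Q u)) _
      rw [h1, h3, Measure.map_apply (hQm u) hq]
      rfl
    · change κ (restr k (Q u), restr k (R u)) _ = κν (restr k (R u)) _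
      rw [h2, h4, Measure.map_apply (hRm u) hq]
      rfl
  filter_upwards [ae_all_iff.2 hq] with ab hab
  have := Measure.isProbabilityMeasure_map (μ := κ ab) measurable_fst.aemeasurable
  have := Measure.isProbabilityMeasure_map (μ := κ ab) measurable_snd.aemeasurable
  refine ⟨Real.measure_eq_of_Iic_rat fun q => ?_, Real.measure_eq_of_Iic_rat fun q => ?_⟩
  · rw [Measure.map_apply measurable_fst measurableSet_Iic]; exact (hab q).1
  · rw [Measure.map_apply measurable_snd measurableSet_Iic]; exact (hab q).2

lemma measurable_pCost (p : ℝ) :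
    Measurable fun xy : (Fin N → ℝ) × (Fin N → ℝ) => pCost p xy.1 xy.2 := by
  unfold pCost
  fun_prop

lemma measurable_cost0 :
    Measurable fun xy : (Fin N → ℝ) × (Fin N → ℝ) => cost0 xy.1 xy.2 := by
  unfold cost0
  fun_prop

lemma AWdist_le_KRdist (p : ℝ) (μ ν : Measure (Fin N → ℝ)) [IsProbabilityMeasure μ]
    [IsProbabilityMeasure ν] : AWdist p μ ν ≤ KRdist p μ ν := by
  obtain ⟨hQ, hQμ⟩ := quantileProcess_spec μ
  obtain ⟨hR, hRν⟩ := quantileProcess_spec ν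
  have hm := hQ.measurable.prodMk hR.measurable
  refine (iInf₂_le _ (isBicausal_map_prodMk hQ hQμ hR hRν)).trans (le_of_eq ?_)
  rw [KRdist, Ldist, lintegral_map measurable_cost0 hm, lintegral_map (measurable_pCost p) hm]

end Bicausal

section CloseInMeasure

variable {Ω : Type*} [MeasurableSpace Ω]

/-- The distance between `X n` and `Y n` tends to zero in `P n`-probability. -/
def CloseInMeasure {E : Type*} [PseudoMetricSpace E] (P : ℕ → Measure Ω) (X Y : ℕ → Ω → E) :
    Prop :=
  ∀ ε : ℝ, 0 < ε → Tendsto (fun n => P n {ω | ε ≤ dist (X n ω) (Y n ω)}) atTop (𝓝 0)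

lemma lintegral_le_add_mul_measure (P : Measure Ω) [IsProbabilityMeasure P] {c : Ω → ℝ≥0∞}
    {C : ℝ≥0∞} (hc : ∀ ω, c ω ≤ C) (ε : ℝ≥0∞) :
    ∫⁻ ω, c ω ∂P ≤ ε + C * P {ω | ε < c ω} := by
  have h : ∀ ω, c ω ≤ ε + {ω | ε < c ω}.indicator (fun _ => C) ω := fun ω => by
    by_cases hω : ε < c ω
    · exact (hc ω).trans (by simp [Set.indicator, hω])
    · exact (not_lt.1 hω).trans le_self_add
  refine (lintegral_mono h).trans ?_
  rw [lintegral_add_left measurable_const, lintegral_const, measure_univ, mul_one]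
  gcongr
  exact lintegral_indicator_const_le _ _

lemma CloseInMeasure.tendsto_lintegral {E : Type*} [PseudoMetricSpace E] {P : ℕ → Measure Ω}
    [∀ n, IsProbabilityMeasure (P n)] {X Y : ℕ → Ω → E} (h : CloseInMeasure P X Y)
    {c : ℕ → Ω → ℝ≥0∞} {C : ℝ≥0∞} (hC : C ≠ ⊤) (hc : ∀ n ω, c n ω ≤ C)
    (hcd : ∀ n ω, c n ω ≤ edist (X n ω) (Y n ω)) :
    Tendsto (fun n => ∫⁻ ω, c n ω ∂P n) atTop (𝓝 0) := by
  refine ENNReal.tendsto_nhds_zero.2 fun ε hε => ?_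
  obtain ⟨δ, hδ, hδε⟩ := ENNReal.lt_iff_exists_nnreal_btwn.1 hε
  have hδ0 : 0 < δ / 2 := half_pos (ENNReal.coe_pos.1 hδ)
  have h1 := ENNReal.Tendsto.const_mul (h (δ / 2 : ℝ≥0) (NNReal.coe_pos.2 hδ0)) (Or.inr hC)
  rw [mul_zero] at h1
  filter_upwards [ENNReal.tendsto_nhds_zero.1 h1 _ (ENNReal.coe_pos.2 hδ0)] with n hn
  refine (lintegral_le_add_mul_measure (P n) (hc n) ((δ / 2 : ℝ≥0) : ℝ≥0∞)).trans ?_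
  calc _ ≤ ((δ / 2 : ℝ≥0) : ℝ≥0∞) +
        C * P n {ω | ((δ / 2 : ℝ≥0) : ℝ) ≤ dist (X n ω) (Y n ω)} := by
        gcongr with ω
        intro hω
        have := hω.le.trans (hcd n ω)
        rw [edist_nndist, ENNReal.coe_le_coe] at this
        rw [dist_nndist]
        exact_mod_cast this
    _ ≤ ((δ / 2 : ℝ≥0) : ℝ≥0∞) + ((δ / 2 : ℝ≥0) : ℝ≥0∞) := by gcongr
    _ = δ := by rw [← ENNReal.coe_add, add_halves]
    _ ≤ ε := hδε.le

lemma CloseInMeasure.uniformContinuous_comp {E F : Type*} [PseudoMetricSpace E]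
    [PseudoMetricSpace F] {P : ℕ → Measure Ω} {X Y : ℕ → Ω → E} (h : CloseInMeasure P X Y)
    {φ : E → F} (hφ : UniformContinuous φ) :
    CloseInMeasure P (fun n ω => φ (X n ω)) (fun n ω => φ (Y n ω)) := by
  intro ε hε
  obtain ⟨δ, hδ, hφδ⟩ := Metric.uniformContinuous_iff.1 hφ ε hε
  refine tendsto_of_tendsto_of_tendsto_of_le_of_le tendsto_const_nhds (h δ hδ)
    (fun _ => zero_le) fun n => measure_mono fun ω hω => ?_
  by_contra hlt
  exact absurd (hφδ (not_le.1 hlt)) (not_lt.2 hω)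

lemma CloseInMeasure.tendsto_lintegral_edist {E F : Type*} [PseudoMetricSpace E]
    [PseudoMetricSpace F] {P : ℕ → Measure Ω} [∀ n, IsProbabilityMeasure (P n)]
    {X Y : ℕ → Ω → E} (h : CloseInMeasure P X Y) {φ : E → F} (hφ : UniformContinuous φ)
    {C : ℝ} (hC : ∀ x y, dist (φ x) (φ y) ≤ C) :
    Tendsto (fun n => ∫⁻ ω, edist (φ (X n ω)) (φ (Y n ω)) ∂P n) atTop (𝓝 0) :=
  (h.uniformContinuous_comp hφ).tendsto_lintegral (C := ENNReal.ofReal C) ENNReal.ofReal_ne_top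
    (fun _ _ => by rw [edist_dist]; exact ENNReal.ofReal_le_ofReal (hC _ _)) fun _ _ => le_rfl

lemma CloseInMeasure.pi {m : ℕ} {P : ℕ → Measure Ω} {X Y : ℕ → Ω → Fin m → ℝ}
    (h : ∀ j, CloseInMeasure P (fun n ω => X n ω j) (fun n ω => Y n ω j)) :
    CloseInMeasure P X Y := by
  intro ε hε
  have h1 : Tendsto (fun n => ∑ j, P n {ω | ε ≤ dist (X n ω j) (Y n ω j)}) atTop (𝓝 0) := by
    simpa using tendsto_finsetSum Finset.univ fun j _ => h j ε hε
  refine tendsto_of_tendsto_of_tendsto_of_le_of_le tendsto_const_nhds h1 (fun _ => zero_le)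
    fun n => ?_
  refine (measure_mono fun ω hω => ?_).trans (measure_iUnion_fintype_le _ _)
  by_contra hn
  simp only [Set.mem_iUnion, Set.mem_ofPred_eq, not_exists, not_le] at hn
  exact absurd ((dist_pi_lt_iff hε).2 hn) (not_lt.2 hω)

lemma closeInMeasure_of_forall_lt {P : Measure Ω} [IsFiniteMeasure P] {X : Ω → ℝ}
    {Xn : ℕ → Ω → ℝ} (hX : Measurable X)
    (h1 : ∀ s t, s < t → Tendsto (fun n => P {ω | X ω < s ∧ t ≤ Xn n ω}) atTop (𝓝 0))
    (h2 : ∀ s t, s < t → Tendsto (fun n => P {ω | Xn n ω < s ∧ t ≤ X ω}) atTop (𝓝 0)) :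
    CloseInMeasure (fun _ => P) Xn (fun _ => X) := by
  intro ε hε
  have hδ : 0 < ε / 2 := half_pos hε
  set δ := ε / 2 with hδ_def
  have htight : Tendsto (fun M : ℕ => P {ω | (M : ℤ) < |⌊X ω / δ⌋|}) atTop (𝓝 0) := by
    have := tendsto_measure_iInter_atTop (μ := P) (s := fun M : ℕ => {ω | (M : ℤ) < |⌊X ω / δ⌋|})
      (fun M => (measurableSet_lt measurable_const
        ((measurable_of_countable fun z : ℤ => |z|).comp
          (Int.measurable_floor.comp (hX.div_const δ)))).nullMeasurableSet)
      (fun M M' hM ω hω => lt_of_le_of_lt (Int.ofNat_le.2 hM) hω) ⟨0, measure_ne_top _ _⟩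
    have h0 : ⋂ M : ℕ, {ω | (M : ℤ) < |⌊X ω / δ⌋|} = ∅ := by
      refine Set.eq_empty_of_forall_notMem fun ω hω => ?_
      have := Set.mem_iInter.1 hω |⌊X ω / δ⌋|.toNat
      simp at this
    rwa [h0, measure_empty] at this
  refine ENNReal.tendsto_nhds_zero.2 fun η hη => ?_
  have hη2 : 0 < η / 2 := ENNReal.half_pos hη.ne'
  obtain ⟨M, hM⟩ := (ENNReal.tendsto_nhds_zero.1 htight _ hη2).exists
  have hgrid : Tendsto (fun n => ∑ j ∈ Finset.Icc (-(M : ℤ) - 1) (M + 1),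
      (P {ω | X ω < j * δ ∧ (j + 1) * δ ≤ Xn n ω} +
        P {ω | Xn n ω < j * δ ∧ (j + 1) * δ ≤ X ω})) atTop (𝓝 0) := by
    have : ∀ j : ℤ, (j : ℝ) * δ < (j + 1) * δ := fun j => by nlinarith
    simpa using tendsto_finsetSum (Finset.Icc (-(M : ℤ) - 1) (M + 1)) fun j _ =>
      (h1 _ _ (this j)).add (h2 _ _ (this j))
  filter_upwards [ENNReal.tendsto_nhds_zero.1 hgrid _ hη2] with n hn
  have hsub : {ω | ε ≤ dist (Xn n ω) (X ω)} ⊆ {ω | (M : ℤ) < |⌊X ω / δ⌋|} ∪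
      ⋃ j ∈ Finset.Icc (-(M : ℤ) - 1) (M + 1), ({ω | X ω < j * δ ∧ (j + 1) * δ ≤ Xn n ω} ∪
        {ω | Xn n ω < j * δ ∧ (j + 1) * δ ≤ X ω}) := by
    intro ω hω
    by_cases hM' : (M : ℤ) < |⌊X ω / δ⌋|
    · exact Or.inl hM'
    refine Or.inr ?_
    have hb := abs_le.1 (not_lt.1 hM')
    have hf1 : (⌊X ω / δ⌋ : ℝ) * δ ≤ X ω := (le_div_iff₀ hδ).1 (Int.floor_le _)
    have hf2 : X ω < ((⌊X ω / δ⌋ : ℝ) + 1) * δ := (div_lt_iff₀ hδ).1 (Int.lt_floor_add_one _)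
    have hω' : ε ≤ |Xn n ω - X ω| := hω
    simp only [Set.mem_iUnion]
    rcases le_abs'.1 hω' with h | h
    · refine ⟨⌊X ω / δ⌋ - 1, Finset.mem_Icc.2 ⟨by omega, by omega⟩, Or.inr ⟨?_, ?_⟩⟩ <;>
        push_cast <;> nlinarith
    · refine ⟨⌊X ω / δ⌋ + 1, Finset.mem_Icc.2 ⟨by omega, by omega⟩, Or.inl ⟨?_, ?_⟩⟩ <;>
        push_cast <;> nlinarith
  calc P {ω | ε ≤ dist (Xn n ω) (X ω)}
      ≤ η / 2 + η / 2 := by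
        refine (measure_mono hsub).trans ((measure_union_le _ _).trans (add_le_add hM ?_))
        refine (measure_biUnion_finset_le _ _).trans (le_trans ?_ hn)
        exact Finset.sum_le_sum fun j _ => measure_union_le _ _
    _ = η := ENNReal.add_halves η

/-- The piecewise linear function which is `0` on `(-∞, s]` and `1` on `[t, ∞)`. -/
noncomputable def ramp (s t x : ℝ) : ℝ := max 0 (min 1 ((x - s) / (t - s)))

lemma ramp_nonneg (s t x : ℝ) : 0 ≤ ramp s t x := le_max_left _ _

lemma ramp_le_one (s t x : ℝ) : ramp s t x ≤ 1 := max_le zero_le_one (min_le_left _ _)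

lemma continuous_ramp (s t : ℝ) : Continuous (ramp s t) := by
  unfold ramp; fun_prop

lemma ramp_of_le {s t x : ℝ} (h : s < t) (hx : x ≤ s) : ramp s t x = 0 :=
  max_eq_left ((min_le_right _ _).trans
    (div_nonpos_of_nonpos_of_nonneg (sub_nonpos.2 hx) (sub_pos.2 h).le))

lemma ramp_of_ge {s t x : ℝ} (h : s < t) (hx : t ≤ x) : ramp s t x = 1 := by
  have : 1 ≤ (x - s) / (t - s) := (one_le_div (sub_pos.2 h)).2 (by linarith)
  rw [ramp, min_eq_left this, max_eq_right zero_le_one]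

lemma uniformContinuous_ramp (s t : ℝ) : UniformContinuous (ramp s t) := by
  have h : LipschitzWith (Real.nnabs (t - s)⁻¹) fun x : ℝ => (x - s) / (t - s) :=
    LipschitzWith.of_dist_le_mul fun x y => by
      simp only [Real.dist_eq, Real.coe_nnabs, ← abs_mul]
      rw [← sub_div, div_eq_inv_mul, sub_sub_sub_cancel_right]
  exact ((h.const_min 1).const_max 0).uniformContinuous

lemma dist_ramp_le (s t x y : ℝ) : dist (ramp s t x) (ramp s t y) ≤ 1 := by
  rw [Real.dist_eq, abs_le]
  constructor <;>
    linarith [ramp_nonneg s t x, ramp_nonneg s t y, ramp_le_one s t x, ramp_le_one s t y]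

lemma lambda01_lt_and_le_le_edist {a b : ℝ → ℝ} (ha : Measurable a) (hb : Measurable b)
    (ham : MonotoneOn a (Ioo 0 1)) (hbm : MonotoneOn b (Ioo 0 1)) {s t : ℝ} (h : s < t) :
    lambda01 {v | b v < s ∧ t ≤ a v} ≤
      edist (∫ v, ramp s t (a v) ∂lambda01) (∫ v, ramp s t (b v) ∂lambda01) := by
  have hmeas : MeasurableSet {v | b v < s ∧ t ≤ a v} :=
    (measurableSet_lt hb measurable_const).inter (measurableSet_le measurable_const ha)
  have hint : ∀ {f : ℝ → ℝ}, Measurable f → Integrable (fun v => ramp s t (f v)) lambda01 :=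
    fun hf => Integrable.of_bound
      ((continuous_ramp s t).measurable.comp hf).aestronglyMeasurable 1
      (Eventually.of_forall fun v => by
        rw [Real.norm_eq_abs, abs_of_nonneg (ramp_nonneg _ _ _)]; exact ramp_le_one _ _ _)
  by_cases hv : ∃ v₀ ∈ Ioo (0 : ℝ) 1, b v₀ < s ∧ t ≤ a v₀
  · obtain ⟨v₀, hv₀, hb₀, ha₀⟩ := hv
    have hle : ∀ᵐ v ∂lambda01, {v | b v < s ∧ t ≤ a v}.indicator (fun _ => (1 : ℝ)) v ≤
        ramp s t (a v) - ramp s t (b v) := by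
      filter_upwards [ae_lambda01_mem_Ioo] with v hv
      by_cases hvm : b v < s ∧ t ≤ a v
      · simp [hvm, ramp_of_le h hvm.1.le, ramp_of_ge h hvm.2]
      · simp only [Set.indicator, Set.mem_ofPred_eq, hvm, if_false, sub_nonneg]
        rcases le_total v v₀ with hle | hle
        · rw [ramp_of_le h ((hbm hv hv₀ hle).trans hb₀.le)]
          exact ramp_nonneg _ _ _
        · rw [ramp_of_ge h (ha₀.trans (ham hv₀ hv hle))]
          exact ramp_le_one _ _ _
    have hI := integral_mono_ae ((integrable_const (1 : ℝ)).indicator hmeas)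
      ((hint ha).sub (hint hb)) hle
    simp only [Pi.sub_apply] at hI
    rw [integral_indicator_const _ hmeas, integral_sub (hint ha) (hint hb), smul_eq_mul,
      mul_one] at hI
    rw [edist_dist, Real.dist_eq, ← ofReal_measureReal]
    exact ENNReal.ofReal_le_ofReal (hI.trans (le_abs_self _))
  · have : lambda01 {v | b v < s ∧ t ≤ a v} = 0 := by
      refine measure_mono_null (t := (Ioo (0 : ℝ) 1)ᶜ) (fun v hv' hv'' => hv ⟨v, hv'', hv'⟩) ?_
      exact ae_lambda01_mem_Ioo
    rw [this]
    exact zero_le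

end CloseInMeasure

section Stability

variable {N : ℕ}

lemma IsBicausal.isProbabilityMeasure {μ ν : Measure (Fin N → ℝ)} [IsProbabilityMeasure μ]
    {π : Measure ((Fin N → ℝ) × (Fin N → ℝ))} (h : IsBicausal μ ν π) : IsProbabilityMeasure π := by
  have : IsProbabilityMeasure (π.map Prod.fst) := h.1.1.symm ▸ inferInstance
  exact Measure.isProbabilityMeasure_of_map Prod.fst

/-- The conditional expectation of `h (Q · k)` given the coordinates before `k`. -/
noncomputable def resampleMean (Q : (Fin N → ℝ) → Fin N → ℝ) (k : Fin N) (h : ℝ → ℝ)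
    (u : Fin N → ℝ) : ℝ :=
  ∫ v, h (Q (Function.update u k v) k) ∂lambda01

lemma measurable_apply_update {Q : (Fin N → ℝ) → Fin N → ℝ} (hQ : Measurable Q) (k : Fin N)
    (u : Fin N → ℝ) : Measurable fun v => Q (Function.update u k v) k :=
  ((measurable_pi_apply k).comp hQ).comp ((measurable_update_pair k).comp measurable_prodMk_left)

lemma IsQuantileProcess.resampleMean_eq {Q : (Fin N → ℝ) → Fin N → ℝ} (hQ : IsQuantileProcess Q)
    {μ : Measure (Fin N → ℝ)} (hμ : (lambdaN N).map Q = μ) (k : Fin N)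
    {κ : Kernel (Fin (k : ℕ) → ℝ) ℝ} [IsMarkovKernel κ]
    (hκ : Disintegrates (μ.map fun x => (restr k x, x k)) κ) {h : ℝ → ℝ} (hh : Continuous h) :
    ∀ᵐ u ∂lambdaN N, resampleMean Q k h u = ∫ z, h z ∂κ (restr k (Q u)) := by
  filter_upwards [hQ.kernel_eq_map hμ k hκ] with u hu
  rw [hu, integral_map (measurable_apply_update hQ.measurable k u).aemeasurable
    hh.aestronglyMeasurable, resampleMean]

lemma IsBicausal.lintegral_edist_integral_le {μ ν : Measure (Fin N → ℝ)} [IsProbabilityMeasure μ]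
    {π : Measure ((Fin N → ℝ) × (Fin N → ℝ))} (hπ : IsBicausal μ ν π) (k : Fin N)
    {h : ℝ → ℝ} (hh : Continuous h) {C : ℝ} (hC : ∀ x, ‖h x‖ ≤ C) :
    ∃ κμ κν : Kernel (Fin (k : ℕ) → ℝ) ℝ, IsMarkovKernel κμ ∧ IsMarkovKernel κν ∧
      Disintegrates (μ.map fun x => (restr k x, x k)) κμ ∧
      Disintegrates (ν.map fun y => (restr k y, y k)) κν ∧
      ∫⁻ xy, edist (∫ z, h z ∂κμ (restr k xy.1)) (∫ z, h z ∂κν (restr k xy.2)) ∂π ≤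
        ∫⁻ xy, edist (h (xy.1 k)) (h (xy.2 k)) ∂π := by
  have := hπ.isProbabilityMeasure
  obtain ⟨κ, κμ, κν, _, _, _, hκμ, hκν, hκ, hc⟩ := hπ.2 k
  refine ⟨κμ, κν, inferInstance, inferInstance, hκμ, hκν, ?_⟩
  have hT := measurable_restr_prod k
  have hX := measurable_apply_prod k
  have hF := (hh.stronglyMeasurable.integral_kernel (κ := κμ)).measurable
  have hG := (hh.stronglyMeasurable.integral_kernel (κ := κν)).measurable
  have hd : Measurable fun z : ℝ × ℝ => edist (h z.1) (h z.2) :=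
    (hh.measurable.comp measurable_fst).edist (hh.measurable.comp measurable_snd)
  have hd' : Measurable fun q : ((Fin (k : ℕ) → ℝ) × (Fin (k : ℕ) → ℝ)) × ℝ × ℝ =>
      edist (h q.2.1) (h q.2.2) := hd.comp measurable_snd
  have hFG : Measurable fun ab : (Fin (k : ℕ) → ℝ) × (Fin (k : ℕ) → ℝ) =>
      edist (∫ z, h z ∂κμ ab.1) (∫ z, h z ∂κν ab.2) :=
    (hF.comp measurable_fst).edist (hG.comp measurable_snd)
  have hcomp := hκ.eq_compProd
  rw [Measure.map_map measurable_fst (hT.prodMk hX)] at hcomp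
  calc ∫⁻ xy, edist (∫ z, h z ∂κμ (restr k xy.1)) (∫ z, h z ∂κν (restr k xy.2)) ∂π
      = ∫⁻ ab, edist (∫ z, h z ∂κμ ab.1) (∫ z, h z ∂κν ab.2)
          ∂(π.map fun xy => (restr k xy.1, restr k xy.2)) := by
        rw [lintegral_map hFG hT]
    _ ≤ ∫⁻ ab, ∫⁻ z, edist (h z.1) (h z.2) ∂κ ab
          ∂(π.map fun xy => (restr k xy.1, restr k xy.2)) := by
        refine lintegral_mono_ae ?_
        filter_upwards [hc] with ab hab
        have i1 : Integrable (fun z : ℝ × ℝ => h z.1) (κ ab) := Integrable.of_bound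
          (hh.comp continuous_fst).aestronglyMeasurable C (Eventually.of_forall fun z => hC z.1)
        have i2 : Integrable (fun z : ℝ × ℝ => h z.2) (κ ab) := Integrable.of_bound
          (hh.comp continuous_snd).aestronglyMeasurable C (Eventually.of_forall fun z => hC z.2)
        rw [← hab.1, ← hab.2, integral_map measurable_fst.aemeasurable hh.aestronglyMeasurable,
          integral_map measurable_snd.aemeasurable hh.aestronglyMeasurable]
        exact edist_integral_le_lintegral_edist i1 i2
    _ = ∫⁻ q, edist (h q.2.1) (h q.2.2)
          ∂(π.map fun xy => ((restr k xy.1, restr k xy.2), (xy.1 k, xy.2 k))) := by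
        conv_rhs => rw [← hcomp]
        rw [Measure.lintegral_compProd hd']
        rfl
    _ = ∫⁻ xy, edist (h (xy.1 k)) (h (xy.2 k)) ∂π := by
        rw [lintegral_map hd' (hT.prodMk hX)]

lemma IsBicausal.lintegral_edist_resampleMean_le {μ ν : Measure (Fin N → ℝ)}
    [IsProbabilityMeasure μ] {π : Measure ((Fin N → ℝ) × (Fin N → ℝ))} (hπ : IsBicausal μ ν π)
    {Q R : (Fin N → ℝ) → Fin N → ℝ} (hQ : IsQuantileProcess Q) (hQμ : (lambdaN N).map Q = μ)
    (hR : IsQuantileProcess R) (hRν : (lambdaN N).map R = ν) (k : Fin N)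
    {h : ℝ → ℝ} (hh : Continuous h) {C : ℝ} (hC : ∀ x, ‖h x‖ ≤ C)
    {g : (Fin (k : ℕ) → ℝ) → ℝ} (hg : Measurable g) :
    ∫⁻ u, edist (resampleMean Q k h u) (resampleMean R k h u) ∂lambdaN N ≤
      ∫⁻ xy, edist (h (xy.1 k)) (h (xy.2 k)) ∂π +
      ∫⁻ xy, edist (g (restr k xy.1)) (g (restr k xy.2)) ∂π +
      ∫⁻ u, edist (g (restr k (Q u))) (g (restr k (R u))) ∂lambdaN N +
      2 * ∫⁻ u, edist (resampleMean R k h u) (g (restr k (R u))) ∂lambdaN N := by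
  obtain ⟨κμ, κν, _, _, hκμ, hκν, hle⟩ := hπ.lintegral_edist_integral_le k hh hC
  have hF := (hh.stronglyMeasurable.integral_kernel (κ := κμ)).measurable
  have hG := (hh.stronglyMeasurable.integral_kernel (κ := κν)).measurable
  set F : (Fin (k : ℕ) → ℝ) → ℝ := fun a => ∫ z, h z ∂κμ a
  set G : (Fin (k : ℕ) → ℝ) → ℝ := fun a => ∫ z, h z ∂κν a
  have hr := measurable_restr k (N := N)
  have hQr := hr.comp hQ.measurable
  have hRr := hr.comp hR.measurable
  have h1 : Measurable fun xy : (Fin N → ℝ) × (Fin N → ℝ) => restr k xy.1 :=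
    hr.comp measurable_fst
  have h2 : Measurable fun xy : (Fin N → ℝ) × (Fin N → ℝ) => restr k xy.2 :=
    hr.comp measurable_snd
  have eQ := hQ.resampleMean_eq hQμ k hκμ hh
  have eR := hR.resampleMean_eq hRν k hκν hh
  have hGg : ∫⁻ u, edist (resampleMean R k h u) (g (restr k (R u))) ∂lambdaN N =
      ∫⁻ u, edist (G (restr k (R u))) (g (restr k (R u))) ∂lambdaN N :=
    lintegral_congr_ae (eR.mono fun u hu => by simp only [hu, G])
  have hGπ : ∫⁻ xy, edist (G (restr k xy.2)) (g (restr k xy.2)) ∂π =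
      ∫⁻ u, edist (G (restr k (R u))) (g (restr k (R u))) ∂lambdaN N := by
    have hm : Measurable fun y : Fin N → ℝ => edist (G (restr k y)) (g (restr k y)) :=
      (hG.comp hr).edist (hg.comp hr)
    rw [← lintegral_map hm measurable_snd, hπ.1.2, ← hRν, lintegral_map hm hR.measurable]
  have hFπ : ∫⁻ xy, edist (F (restr k xy.1)) (g (restr k xy.1)) ∂π =
      ∫⁻ u, edist (F (restr k (Q u))) (g (restr k (Q u))) ∂lambdaN N := by
    have hm : Measurable fun y : Fin N → ℝ => edist (F (restr k y)) (g (restr k y)) :=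
      (hF.comp hr).edist (hg.comp hr)
    rw [← lintegral_map hm measurable_fst, hπ.1.1, ← hQμ, lintegral_map hm hQ.measurable]
  have m1 : Measurable fun u => edist (F (restr k (Q u))) (g (restr k (Q u))) :=
    (hF.comp hQr).edist (hg.comp hQr)
  have m2 : Measurable fun u => edist (g (restr k (Q u))) (g (restr k (R u))) :=
    (hg.comp hQr).edist (hg.comp hRr)
  have m3 : Measurable fun xy : (Fin N → ℝ) × (Fin N → ℝ) =>
      edist (F (restr k xy.1)) (G (restr k xy.2)) := (hF.comp h1).edist (hG.comp h2)
  have m4 : Measurable fun xy : (Fin N → ℝ) × (Fin N → ℝ) =>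
      edist (G (restr k xy.2)) (g (restr k xy.2)) := (hG.comp h2).edist (hg.comp h2)
  have hFg : ∫⁻ u, edist (F (restr k (Q u))) (g (restr k (Q u))) ∂lambdaN N ≤
      ∫⁻ xy, edist (h (xy.1 k)) (h (xy.2 k)) ∂π +
        (∫⁻ u, edist (G (restr k (R u))) (g (restr k (R u))) ∂lambdaN N +
          ∫⁻ xy, edist (g (restr k xy.1)) (g (restr k xy.2)) ∂π) := by
    rw [← hFπ, ← hGπ]
    refine (lintegral_mono (g := fun xy : (Fin N → ℝ) × (Fin N → ℝ) =>
      edist (F (restr k xy.1)) (G (restr k xy.2)) + (edist (G (restr k xy.2)) (g (restr k xy.2)) +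
        edist (g (restr k xy.1)) (g (restr k xy.2)))) fun xy => ?_).trans ?_
    · beta_reduce
      rw [edist_comm (g (restr k xy.1)) (g (restr k xy.2)), ← add_assoc]
      exact edist_triangle4 _ _ _ _
    · rw [lintegral_add_left m3, lintegral_add_left m4]
      gcongr
  rw [hGg]
  calc ∫⁻ u, edist (resampleMean Q k h u) (resampleMean R k h u) ∂lambdaN N
      = ∫⁻ u, edist (F (restr k (Q u))) (G (restr k (R u))) ∂lambdaN N :=
        lintegral_congr_ae (by filter_upwards [eQ, eR] with u hu hu'; simp only [hu, hu', F, G])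
    _ ≤ ∫⁻ u, (edist (F (restr k (Q u))) (g (restr k (Q u))) +
          (edist (g (restr k (Q u))) (g (restr k (R u))) +
            edist (G (restr k (R u))) (g (restr k (R u))))) ∂lambdaN N :=
        lintegral_mono fun u => by
          rw [edist_comm (G _) (g _), ← add_assoc]
          exact edist_triangle4 _ _ _ _
    _ = ∫⁻ u, edist (F (restr k (Q u))) (g (restr k (Q u))) ∂lambdaN N +
          (∫⁻ u, edist (g (restr k (Q u))) (g (restr k (R u))) ∂lambdaN N +
            ∫⁻ u, edist (G (restr k (R u))) (g (restr k (R u))) ∂lambdaN N) := by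
        rw [lintegral_add_left m1, lintegral_add_left m2]
    _ ≤ ∫⁻ xy, edist (h (xy.1 k)) (h (xy.2 k)) ∂π +
          (∫⁻ u, edist (G (restr k (R u))) (g (restr k (R u))) ∂lambdaN N +
            ∫⁻ xy, edist (g (restr k xy.1)) (g (restr k xy.2)) ∂π) +
          (∫⁻ u, edist (g (restr k (Q u))) (g (restr k (R u))) ∂lambdaN N +
            ∫⁻ u, edist (G (restr k (R u))) (g (restr k (R u))) ∂lambdaN N) := by
        gcongr
    _ = _ := by ring

lemma IsQuantileProcess.exists_lintegral_edist_resampleMean_le {R : (Fin N → ℝ) → Fin N → ℝ}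
    (hR : IsQuantileProcess R) (k : Fin N) {h : ℝ → ℝ} (hh : Continuous h) {C : ℝ}
    (hC : ∀ x, ‖h x‖ ≤ C) {ε : ℝ≥0∞} (hε : ε ≠ 0) :
    ∃ g : (Fin (k : ℕ) → ℝ) → ℝ, UniformContinuous g ∧ (∃ D, ∀ x y, dist (g x) (g y) ≤ D) ∧
      ∫⁻ u, edist (resampleMean R k h u) (g (restr k (R u))) ∂lambdaN N ≤ ε := by
  have : IsProbabilityMeasure ((lambdaN N).map R) :=
    Measure.isProbabilityMeasure_map hR.measurable.aemeasurable
  have hr := measurable_restr k (N := N)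
  set ρ := ((lambdaN N).map R).map (restr k) with hρ
  have : IsProbabilityMeasure ρ := Measure.isProbabilityMeasure_map hr.aemeasurable
  have hκ := disintegrates_condDistrib (P := (lambdaN N).map R) hr (measurable_pi_apply k)
  set κ := condDistrib (fun x : Fin N → ℝ => x k) (restr k) ((lambdaN N).map R)
  have hG := hh.stronglyMeasurable.integral_kernel (κ := κ)
  have hGi : Integrable (fun a => ∫ z, h z ∂κ a) ρ := Integrable.of_bound
    hG.aestronglyMeasurable C (Eventually.of_forall fun a => by
      simpa using norm_integral_le_of_norm_le_const (μ := κ a) (Eventually.of_forall hC))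
  obtain ⟨g, hgc, hgε, hg, -⟩ := hGi.exists_hasCompactSupport_lintegral_sub_le hε
  obtain ⟨D, hD⟩ := hg.bounded_above_of_compact_support hgc
  refine ⟨g, hgc.uniformContinuous_of_continuous hg,
    ⟨D + D, fun x y => (dist_le_norm_add_norm _ _).trans (add_le_add (hD x) (hD y))⟩,
    le_trans (le_of_eq ?_) hgε⟩
  have hm : Measurable fun a => ‖∫ z, h z ∂κ a - g a‖ₑ :=
    (hG.measurable.sub hg.measurable).enorm
  rw [hρ, Measure.map_map hr hR.measurable, lintegral_map hm (hr.comp hR.measurable)]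
  exact lintegral_congr_ae ((hR.resampleMean_eq rfl k hκ hh).mono fun u hu => by
    simp only [hu, edist_eq_enorm_sub, Function.comp_apply])

lemma IsQuantileProcess.monotoneOn_update {Q : (Fin N → ℝ) → Fin N → ℝ}
    (hQ : IsQuantileProcess Q) (k : Fin N) {u : Fin N → ℝ} (hu : u ∈ cube N) :
    MonotoneOn (fun v => Q (Function.update u k v) k) (Ioo 0 1) := fun v hv w hw hvw =>
  hQ.inc k _ (update_mem_cube hu k hv) _ (update_mem_cube hu k hw)
    (fun j hj => by simp [hj.ne]) (by simpa using hvw)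

lemma IsQuantileProcess.measure_lt_and_le_le {Q R : (Fin N → ℝ) → Fin N → ℝ}
    (hQ : IsQuantileProcess Q) (hR : IsQuantileProcess R) (k : Fin N) {s t : ℝ} (h : s < t) :
    lambdaN N {u | R u k < s ∧ t ≤ Q u k} ≤
      ∫⁻ u, edist (resampleMean Q k (ramp s t) u) (resampleMean R k (ramp s t) u)
        ∂lambdaN N := by
  have hS : MeasurableSet {u | R u k < s ∧ t ≤ Q u k} :=
    (measurableSet_lt ((measurable_pi_apply k).comp hR.measurable) measurable_const).inter
      (measurableSet_le measurable_const ((measurable_pi_apply k).comp hQ.measurable))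
  rw [lambdaN_apply_update k hS]
  refine lintegral_mono_ae ?_
  filter_upwards [ae_mem_cube] with u hu
  exact lambda01_lt_and_le_le_edist (measurable_apply_update hQ.measurable k u)
    (measurable_apply_update hR.measurable k u) (hQ.monotoneOn_update k hu)
    (hR.monotoneOn_update k hu) h

/-- If the two marginals of bicausal couplings are close in probability, so are the quantile
processes. -/
lemma closeInMeasure_quantileProcess {μn : ℕ → Measure (Fin N → ℝ)}
    [∀ n, IsProbabilityMeasure (μn n)] {μ : Measure (Fin N → ℝ)}
    {πn : ℕ → Measure ((Fin N → ℝ) × (Fin N → ℝ))} (hπ : ∀ n, IsBicausal (μn n) μ (πn n))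
    {Qn : ℕ → (Fin N → ℝ) → Fin N → ℝ} (hQn : ∀ n, IsQuantileProcess (Qn n))
    (hQnμ : ∀ n, (lambdaN N).map (Qn n) = μn n)
    {Q : (Fin N → ℝ) → Fin N → ℝ} (hQ : IsQuantileProcess Q) (hQμ : (lambdaN N).map Q = μ)
    (hclose : ∀ k, CloseInMeasure πn (fun _ xy => xy.1 k) (fun _ xy => xy.2 k)) (k : Fin N) :
    CloseInMeasure (fun _ => lambdaN N) (fun n u => Qn n u k) (fun _ u => Q u k) := by
  have := fun n => (hπ n).isProbabilityMeasure
  induction k using WellFoundedLT.induction with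
  | ind k ih =>
  have hpast : CloseInMeasure πn (fun _ xy => restr k xy.1) (fun _ xy => restr k xy.2) :=
    CloseInMeasure.pi fun j => hclose ⟨j, j.isLt.trans k.isLt⟩
  have hpast' : CloseInMeasure (fun _ => lambdaN N) (fun n u => restr k (Qn n u))
      (fun _ u => restr k (Q u)) :=
    CloseInMeasure.pi fun j => ih ⟨j, j.isLt.trans k.isLt⟩ j.isLt
  have hmean : ∀ s t : ℝ, Tendsto (fun n => ∫⁻ u, edist (resampleMean (Qn n) k (ramp s t) u)
      (resampleMean Q k (ramp s t) u) ∂lambdaN N) atTop (𝓝 0) := by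
    intro s t
    have hC : ∀ x, ‖ramp s t x‖ ≤ 1 := fun x => by
      rw [Real.norm_eq_abs, abs_of_nonneg (ramp_nonneg _ _ _)]
      exact ramp_le_one _ _ _
    refine ENNReal.tendsto_nhds_zero.2 fun ε hε => ?_
    have hε2 := ENNReal.half_pos hε.ne'
    obtain ⟨g, hg, ⟨D, hD⟩, hgε⟩ := hQ.exists_lintegral_edist_resampleMean_le k
      (continuous_ramp s t) hC (ENNReal.half_pos hε2.ne').ne'
    have hlim := (((hclose k).tendsto_lintegral_edist (uniformContinuous_ramp s t)
      (dist_ramp_le s t)).add (hpast.tendsto_lintegral_edist hg hD)).add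
      (hpast'.tendsto_lintegral_edist hg hD)
    rw [add_zero, add_zero] at hlim
    filter_upwards [ENNReal.tendsto_nhds_zero.1 hlim _ hε2] with n hn
    refine ((hπ n).lintegral_edist_resampleMean_le (hQn n) (hQnμ n) hQ hQμ k
      (continuous_ramp s t) hC hg.continuous.measurable).trans ?_
    refine (add_le_add hn (mul_le_mul_right hgε 2)).trans ?_
    rw [two_mul, ENNReal.add_halves, ENNReal.add_halves]
  refine closeInMeasure_of_forall_lt ((measurable_pi_apply k).comp hQ.measurable)
    (fun s t h => ?_) fun s t h => ?_
  · exact tendsto_of_tendsto_of_tendsto_of_le_of_le tendsto_const_nhds (hmean s t)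
      (fun _ => zero_le) fun n => (hQn n).measure_lt_and_le_le hQ k h
  · refine tendsto_of_tendsto_of_tendsto_of_le_of_le tendsto_const_nhds (hmean s t)
      (fun _ => zero_le) fun n => (hQ.measure_lt_and_le_le (hQn n) k h).trans_eq ?_
    simp only [edist_comm]

end Stability

section Moments

/-- Truncation of a real number at level `R`. -/
noncomputable def clamp (R x : ℝ) : ℝ := max (-R) (min R x)

/-- The distance of `x` to the interval `[-R, R]`. -/
noncomputable def excess (R x : ℝ) : ℝ≥0∞ := ENNReal.ofReal (|x| - R)

lemma uniformContinuous_clamp (R : ℝ) : UniformContinuous (clamp R) :=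
  ((LipschitzWith.id.const_min R).const_max (-R)).uniformContinuous

lemma dist_clamp_le {R : ℝ} (hR : 0 ≤ R) (x y : ℝ) : dist (clamp R x) (clamp R y) ≤ 2 * R := by
  have h : ∀ z, |clamp R z| ≤ R := fun z =>
    abs_le.2 ⟨le_max_left _ _, max_le (by linarith) (min_le_left _ _)⟩
  rw [Real.dist_eq]
  linarith [abs_sub (clamp R x) (clamp R y), h x, h y]

@[fun_prop]
lemma measurable_excess (R : ℝ) : Measurable (excess R) := by
  unfold excess; fun_prop

lemma edist_le_edist_clamp_add {R : ℝ} (hR : 0 ≤ R) (x y : ℝ) :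
    edist x y ≤ edist (clamp R x) (clamp R y) + (excess R x + excess R y) := by
  have h : ∀ z, edist z (clamp R z) ≤ excess R z := fun z => by
    rw [edist_dist, Real.dist_eq, excess, ENNReal.ofReal_le_ofReal_iff', clamp]
    rcases le_total z R with h1 | h1
    · rcases le_total (-R) z with h2 | h2
      · rw [min_eq_right h1, max_eq_right h2]; simp
      · rw [min_eq_right h1, max_eq_left h2, abs_of_nonpos (by linarith),
          abs_of_nonpos (by linarith)]
        left; linarith
    · rw [min_eq_left h1, max_eq_right (by linarith), abs_of_nonneg (by linarith),
        abs_of_nonneg (by linarith)]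
      left; linarith
  calc edist x y ≤ edist x (clamp R x) + edist (clamp R x) (clamp R y) + edist (clamp R y) y :=
        edist_triangle4 _ _ _ _
    _ ≤ excess R x + edist (clamp R x) (clamp R y) + excess R y := by
        gcongr
        · exact h x
        · rw [edist_comm]; exact h y
    _ = _ := by ring

lemma excess_le_edist_add (R x y : ℝ) : excess R x ≤ edist x y + excess R y := by
  rw [edist_dist, Real.dist_eq, excess, excess]
  refine (ENNReal.ofReal_le_ofReal ?_).trans ENNReal.ofReal_add_le
  linarith [abs_sub_abs_le_abs_sub x y]

lemma excess_le_enorm {R : ℝ} (hR : 0 ≤ R) (x : ℝ) : excess R x ≤ ‖x‖ₑ := by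
  rw [excess, Real.enorm_eq_ofReal_abs]
  exact ENNReal.ofReal_le_ofReal (by linarith)

lemma tendsto_lintegral_excess_rpow {Ω : Type*} [MeasurableSpace Ω] {P : Measure Ω} {p : ℝ}
    (hp : 0 < p) {A : Ω → ℝ} (hA : Measurable A) (hAp : ∫⁻ ω, ‖A ω‖ₑ ^ p ∂P < ⊤) :
    Tendsto (fun R : ℕ => ∫⁻ ω, excess R (A ω) ^ p ∂P) atTop (𝓝 0) := by
  have := tendsto_lintegral_of_dominated_convergence (μ := P)
    (F := fun (R : ℕ) ω => excess R (A ω) ^ p) (f := fun _ => 0) (fun ω => ‖A ω‖ₑ ^ p)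
    (fun R => by fun_prop)
    (fun R => Eventually.of_forall fun ω =>
      ENNReal.rpow_le_rpow (excess_le_enorm R.cast_nonneg _) hp.le) hAp.ne
    (Eventually.of_forall fun ω => by
      obtain ⟨M, hM⟩ := exists_nat_ge |A ω|
      refine tendsto_const_nhds.congr' ?_
      filter_upwards [eventually_ge_atTop M] with R hR
      have : |A ω| - R ≤ 0 := sub_nonpos.2 (hM.trans (Nat.cast_le.2 hR))
      rw [excess, ENNReal.ofReal_of_nonpos this, ENNReal.zero_rpow_of_pos hp])
  simpa using this

lemma lintegral_rpow_add_le {Ω : Type*} [MeasurableSpace Ω] {P : Measure Ω} {p : ℝ} (hp : 1 ≤ p)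
    {a b c : Ω → ℝ≥0∞} (ha : Measurable a) (h : ∀ ω, c ω ≤ a ω + b ω) :
    ∫⁻ ω, c ω ^ p ∂P ≤ 2 ^ (p - 1) * (∫⁻ ω, a ω ^ p ∂P + ∫⁻ ω, b ω ^ p ∂P) := by
  calc ∫⁻ ω, c ω ^ p ∂P ≤ ∫⁻ ω, 2 ^ (p - 1) * (a ω ^ p + b ω ^ p) ∂P :=
        lintegral_mono fun ω => (ENNReal.rpow_le_rpow (h ω) (by linarith)).trans
          (ENNReal.rpow_add_le_mul_rpow_add_rpow _ _ hp)
    _ = _ := by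
        rw [lintegral_const_mul' _ _ (ENNReal.rpow_ne_top_of_nonneg (by linarith) (by simp)),
          lintegral_add_left (by fun_prop)]

/-- Convergence in probability upgrades to convergence in `L_p` if the laws can be coupled with
vanishing `L_p`-cost. -/
lemma CloseInMeasure.tendsto_lintegral_edist_rpow {Ω Ω' : Type*} [MeasurableSpace Ω]
    [MeasurableSpace Ω'] {P : Measure Ω} [IsProbabilityMeasure P] {πn : ℕ → Measure Ω'} {p : ℝ}
    (hp : 1 ≤ p) {An : ℕ → Ω → ℝ} {A : Ω → ℝ} {X Y : Ω' → ℝ} (hAn : ∀ n, Measurable (An n))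
    (hA : Measurable A) (hX : Measurable X) (hY : Measurable Y)
    (hXA : ∀ n, (πn n).map X = P.map (An n)) (hYA : ∀ n, (πn n).map Y = P.map A)
    (hAp : ∫⁻ ω, ‖A ω‖ₑ ^ p ∂P < ⊤)
    (hXY : Tendsto (fun n => ∫⁻ ω, edist (X ω) (Y ω) ^ p ∂πn n) atTop (𝓝 0))
    (hclose : CloseInMeasure (fun _ => P) An (fun _ => A)) :
    Tendsto (fun n => ∫⁻ ω, edist (An n ω) (A ω) ^ p ∂P) atTop (𝓝 0) := by
  have hp0 : 0 < p := by linarith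
  have hK : (2 : ℝ≥0∞) ^ (p - 1) ≠ ⊤ := ENNReal.rpow_ne_top_of_nonneg (by linarith) (by simp)
  set K : ℝ≥0∞ := 2 ^ (p - 1)
  have hclamp : ∀ R : ℕ, Tendsto (fun n => ∫⁻ ω, edist (clamp R (An n ω)) (clamp R (A ω)) ^ p ∂P)
      atTop (𝓝 0) := by
    intro R
    have hR : (0 : ℝ) ≤ R := R.cast_nonneg
    have hL : ENNReal.ofReal (2 * R) ^ (p - 1) ≠ ⊤ :=
      ENNReal.rpow_ne_top_of_nonneg (by linarith) ENNReal.ofReal_ne_top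
    have h0 := ENNReal.Tendsto.const_mul (hclose.tendsto_lintegral_edist
      (uniformContinuous_clamp R) (dist_clamp_le hR)) (Or.inr hL)
    rw [mul_zero] at h0
    refine tendsto_of_tendsto_of_tendsto_of_le_of_le tendsto_const_nhds h0 (fun _ => zero_le)
      fun n => ?_
    beta_reduce
    rw [← lintegral_const_mul' _ _ hL]
    refine lintegral_mono fun ω => ?_
    have hb : edist (clamp R (An n ω)) (clamp R (A ω)) ≤ ENNReal.ofReal (2 * R) := by
      rw [edist_dist]; exact ENNReal.ofReal_le_ofReal (dist_clamp_le hR _ _)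
    calc edist (clamp R (An n ω)) (clamp R (A ω)) ^ p
        = edist (clamp R (An n ω)) (clamp R (A ω)) ^ (p - 1) *
          edist (clamp R (An n ω)) (clamp R (A ω)) := by
          conv_lhs => rw [← sub_add_cancel p 1]
          rw [ENNReal.rpow_add_of_nonneg _ _ (by linarith) zero_le_one, ENNReal.rpow_one]
      _ ≤ _ := by gcongr
  have hbound : ∀ R n : ℕ, ∫⁻ ω, edist (An n ω) (A ω) ^ p ∂P ≤
      K * (∫⁻ ω, edist (clamp R (An n ω)) (clamp R (A ω)) ^ p ∂P +
        K * (K * (∫⁻ ω, edist (X ω) (Y ω) ^ p ∂πn n + ∫⁻ ω, excess R (A ω) ^ p ∂P) +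
          ∫⁻ ω, excess R (A ω) ^ p ∂P)) := by
    intro R n
    have hm : Measurable fun x => excess R x ^ p := by fun_prop
    have hEY : ∫⁻ ω, excess R (Y ω) ^ p ∂πn n = ∫⁻ ω, excess R (A ω) ^ p ∂P := by
      rw [← lintegral_map hm hY, hYA, lintegral_map hm hA]
    have hEX : ∫⁻ ω, excess R (X ω) ^ p ∂πn n = ∫⁻ ω, excess R (An n ω) ^ p ∂P := by
      rw [← lintegral_map hm hX, hXA, lintegral_map hm (hAn n)]
    have hcm := (uniformContinuous_clamp R).continuous.measurable
    refine (lintegral_rpow_add_le hp ((hcm.comp (hAn n)).edist (hcm.comp hA))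
      fun ω => edist_le_edist_clamp_add R.cast_nonneg (An n ω) (A ω)).trans ?_
    refine mul_le_mul_right (add_le_add_right ?_ _) _
    refine (lintegral_rpow_add_le hp ((measurable_excess R).comp (hAn n)) fun ω =>
      le_rfl).trans ?_
    refine mul_le_mul_right (add_le_add_left ?_ _) _
    change ∫⁻ ω, excess R (An n ω) ^ p ∂P ≤ _
    rw [← hEX, ← hEY]
    exact lintegral_rpow_add_le hp (hX.edist hY) fun ω => excess_le_edist_add R (X ω) (Y ω)
  refine ENNReal.tendsto_nhds_zero.2 fun ε hε => ?_
  have hexc := tendsto_lintegral_excess_rpow hp0 hA hAp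
  have hlimR : Tendsto (fun R : ℕ => K * (0 + K * (K * (0 + ∫⁻ ω, excess R (A ω) ^ p ∂P) +
      ∫⁻ ω, excess R (A ω) ^ p ∂P))) atTop (𝓝 (K * (0 + K * (K * (0 + 0) + 0)))) :=
    ENNReal.Tendsto.const_mul (tendsto_const_nhds.add (ENNReal.Tendsto.const_mul
      ((ENNReal.Tendsto.const_mul (tendsto_const_nhds.add hexc) (Or.inr hK)).add hexc)
      (Or.inr hK))) (Or.inr hK)
  obtain ⟨R, hR⟩ := (hlimR.eventually_lt_const (u := ε) (by simpa using hε)).exists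
  have hlimn := ENNReal.Tendsto.const_mul ((hclamp R).add (ENNReal.Tendsto.const_mul
    ((ENNReal.Tendsto.const_mul (hXY.add (tendsto_const_nhds
      (x := ∫⁻ ω, excess R (A ω) ^ p ∂P))) (Or.inr hK)).add (tendsto_const_nhds
      (x := ∫⁻ ω, excess R (A ω) ^ p ∂P))) (Or.inr hK))) (Or.inr hK)
  filter_upwards [hlimn.eventually_lt_const hR] with n hn
  exact (hbound R n).trans hn.le

end Moments

section Metrization

variable {N : ℕ}

lemma pCost_eq_sum_edist {p : ℝ} (hp : 0 ≤ p) (x y : Fin N → ℝ) :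
    pCost p x y = ∑ k, edist (x k) (y k) ^ p :=
  Finset.sum_congr rfl fun k _ => by
    rw [edist_dist, Real.dist_eq, ENNReal.ofReal_rpow_of_nonneg (abs_nonneg _) hp]

lemma closeInMeasure_of_tendsto_lintegral {Ω E : Type*} [MeasurableSpace Ω] [PseudoMetricSpace E]
    {P : ℕ → Measure Ω} {X Y : ℕ → Ω → E} {c : Ω → ℝ≥0∞} (hc : Measurable c)
    (h : Tendsto (fun n => ∫⁻ ω, c ω ∂P n) atTop (𝓝 0))
    (hδ : ∀ ε : ℝ, 0 < ε → ∃ δ : ℝ≥0∞, δ ≠ 0 ∧ δ ≠ ⊤ ∧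
      ∀ n ω, ε ≤ dist (X n ω) (Y n ω) → δ ≤ c ω) :
    CloseInMeasure P X Y := by
  intro ε hε
  obtain ⟨δ, hδ0, hδt, hδc⟩ := hδ ε hε
  have h1 := ENNReal.Tendsto.div_const h (Or.inr hδ0)
  rw [ENNReal.zero_div] at h1
  exact tendsto_of_tendsto_of_tendsto_of_le_of_le tendsto_const_nhds h1 (fun _ => zero_le)
    fun n => (measure_mono fun ω hω => hδc n ω hω).trans
      (meas_ge_le_lintegral_div hc.aemeasurable hδ0 hδt)

/-- The transport cost minimized in the definition of `AWdist`. -/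
noncomputable def transportCost (p : ℝ) (π : Measure ((Fin N → ℝ) × (Fin N → ℝ))) : ℝ≥0∞ :=
  if p = 0 then ∫⁻ xy, cost0 xy.1 xy.2 ∂π else (∫⁻ xy, pCost p xy.1 xy.2 ∂π) ^ p⁻¹

lemma exists_isBicausal_transportCost_le (p : ℝ) (μ ν : Measure (Fin N → ℝ))
    [IsProbabilityMeasure μ] [IsProbabilityMeasure ν] {ε : ℝ≥0∞} (hε : ε ≠ 0) :
    ∃ π, IsBicausal μ ν π ∧ transportCost p π ≤ AWdist p μ ν + ε := by
  rcases eq_or_ne (AWdist p μ ν) ⊤ with htop | htop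
  · obtain ⟨hQ, hQμ⟩ := quantileProcess_spec μ
    obtain ⟨hR, hRν⟩ := quantileProcess_spec ν
    exact ⟨_, isBicausal_map_prodMk hQ hQμ hR hRν, by simp [htop]⟩
  · have hlt : AWdist p μ ν < AWdist p μ ν + ε := ENNReal.lt_add_right htop hε
    conv_lhs at hlt => unfold AWdist
    simp only [iInf_lt_iff] at hlt
    obtain ⟨π, hπ, hlt⟩ := hlt
    exact ⟨π, hπ, hlt.le⟩

lemma exists_isBicausal_tendsto_transportCost {p : ℝ} {μn : ℕ → Measure (Fin N → ℝ)}
    {μ : Measure (Fin N → ℝ)} [∀ n, IsProbabilityMeasure (μn n)] [IsProbabilityMeasure μ]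
    (h : Tendsto (fun n => AWdist p (μn n) μ) atTop (𝓝 0)) :
    ∃ πn : ℕ → Measure ((Fin N → ℝ) × (Fin N → ℝ)), (∀ n, IsBicausal (μn n) μ (πn n)) ∧
      Tendsto (fun n => transportCost p (πn n)) atTop (𝓝 0) := by
  choose πn hπn hle using fun n : ℕ => exists_isBicausal_transportCost_le p (μn n) μ
    (ENNReal.inv_ne_zero.2 (ENNReal.natCast_ne_top n))
  refine ⟨πn, hπn, tendsto_of_tendsto_of_tendsto_of_le_of_le tendsto_const_nhds ?_
    (fun _ => zero_le) hle⟩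
  simpa using h.add ENNReal.tendsto_inv_nat_nhds_zero

lemma tendsto_KRdist_zero_of_tendsto_transportCost {μn : ℕ → Measure (Fin N → ℝ)}
    {μ : Measure (Fin N → ℝ)} [∀ n, IsProbabilityMeasure (μn n)] [IsProbabilityMeasure μ]
    {πn : ℕ → Measure ((Fin N → ℝ) × (Fin N → ℝ))} (hπ : ∀ n, IsBicausal (μn n) μ (πn n))
    (h : Tendsto (fun n => transportCost 0 (πn n)) atTop (𝓝 0)) :
    Tendsto (fun n => KRdist 0 (μn n) μ) atTop (𝓝 0) := by
  simp only [transportCost, if_true] at h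
  have hclose : ∀ k, CloseInMeasure πn (fun _ xy => xy.1 k) (fun _ xy => xy.2 k) := fun k =>
    closeInMeasure_of_tendsto_lintegral measurable_cost0 h fun ε hε =>
      ⟨ENNReal.ofReal (min ε 1), by simp [hε], ENNReal.ofReal_ne_top, fun n xy hxy =>
        ENNReal.ofReal_le_ofReal (min_le_min_right _
          (hxy.trans ((dist_le_pi_dist xy.1 xy.2 k).trans_eq (dist_eq_norm _ _))))⟩
  have hQ := CloseInMeasure.pi (closeInMeasure_quantileProcess hπ
    (fun n => (quantileProcess_spec (μn n)).1) (fun n => (quantileProcess_spec (μn n)).2)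
    (quantileProcess_spec μ).1 (quantileProcess_spec μ).2 hclose)
  simp only [KRdist, Ldist, if_true]
  refine hQ.tendsto_lintegral ENNReal.one_ne_top (fun n u => ?_) fun n u => ?_
  · exact ENNReal.ofReal_le_one.2 (min_le_right _ _)
  · rw [edist_dist, dist_eq_norm]
    exact ENNReal.ofReal_le_ofReal (min_le_left _ _)

lemma tendsto_KRdist_of_tendsto_transportCost {p : ℝ} (hp : 1 ≤ p)
    {μn : ℕ → Measure (Fin N → ℝ)} {μ : Measure (Fin N → ℝ)}
    [∀ n, IsProbabilityMeasure (μn n)] [IsProbabilityMeasure μ]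
    (hμ : ∫⁻ x, ∑ k, ENNReal.ofReal (|x k| ^ p) ∂μ < ⊤)
    {πn : ℕ → Measure ((Fin N → ℝ) × (Fin N → ℝ))} (hπ : ∀ n, IsBicausal (μn n) μ (πn n))
    (h : Tendsto (fun n => transportCost p (πn n)) atTop (𝓝 0)) :
    Tendsto (fun n => KRdist p (μn n) μ) atTop (𝓝 0) := by
  have hp0 : 0 < p := by linarith
  have hQn := fun n => (quantileProcess_spec (μn n)).1
  have hQnμ := fun n => (quantileProcess_spec (μn n)).2
  obtain ⟨hQ, hQμ⟩ := quantileProcess_spec μ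
  have hcost : Tendsto (fun n => ∫⁻ xy, pCost p xy.1 xy.2 ∂πn n) atTop (𝓝 0) := by
    have := (ENNReal.continuous_rpow_const (y := p)).continuousAt.tendsto.comp h
    simpa [transportCost, hp0.ne', Function.comp_def, ENNReal.rpow_inv_rpow hp0.ne',
      ENNReal.zero_rpow_of_pos hp0] using this
  have hle : ∀ k (xy : (Fin N → ℝ) × (Fin N → ℝ)),
      edist (xy.1 k) (xy.2 k) ^ p ≤ pCost p xy.1 xy.2 := fun k xy => by
    rw [pCost_eq_sum_edist hp0.le]
    exact Finset.single_le_sum (f := fun k => edist (xy.1 k) (xy.2 k) ^ p)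
      (fun _ _ => zero_le) (Finset.mem_univ k)
  have hclose : ∀ k, CloseInMeasure πn (fun _ xy => xy.1 k) (fun _ xy => xy.2 k) := fun k =>
    closeInMeasure_of_tendsto_lintegral (measurable_pCost p) hcost fun ε hε =>
      ⟨ENNReal.ofReal ε ^ p, by simp [hε], by simp [hp0.le],
        fun n xy hxy => le_trans (by rw [edist_dist]; gcongr) (hle k xy)⟩
  have hcoord : ∀ k, Tendsto (fun n => ∫⁻ u, edist (quantileProcess (μn n) u k)
      (quantileProcess μ u k) ^ p ∂lambdaN N) atTop (𝓝 0) := by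
    intro k
    have hk : Measurable fun x : Fin N → ℝ => x k := measurable_pi_apply k
    refine CloseInMeasure.tendsto_lintegral_edist_rpow hp (πn := πn)
      (X := fun xy => xy.1 k) (Y := fun xy => xy.2 k)
      (fun n => hk.comp (hQn n).measurable) (hk.comp hQ.measurable) (hk.comp measurable_fst)
      (hk.comp measurable_snd) (fun n => ?_) (fun n => ?_) ?_ ?_
      (closeInMeasure_quantileProcess hπ hQn hQnμ hQ hQμ hclose k)
    · change (πn n).map ((fun x : Fin N → ℝ => x k) ∘ Prod.fst) =
        (lambdaN N).map ((fun x : Fin N → ℝ => x k) ∘ quantileProcess (μn n))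
      rw [← Measure.map_map hk measurable_fst, (hπ n).1.1,
        ← Measure.map_map hk (hQn n).measurable, hQnμ n]
    · change (πn n).map ((fun x : Fin N → ℝ => x k) ∘ Prod.snd) =
        (lambdaN N).map ((fun x : Fin N → ℝ => x k) ∘ quantileProcess μ)
      rw [← Measure.map_map hk measurable_snd, (hπ n).1.2,
        ← Measure.map_map hk hQ.measurable, hQμ]
    · refine lt_of_le_of_lt ?_ hμ
      have hm : Measurable fun x : Fin N → ℝ => ‖x k‖ₑ ^ p := by fun_prop
      rw [← lintegral_map hm hQ.measurable, hQμ]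
      refine lintegral_mono fun x => ?_
      rw [Real.enorm_eq_ofReal_abs, ENNReal.ofReal_rpow_of_nonneg (abs_nonneg _) hp0.le]
      exact Finset.single_le_sum (f := fun k => ENNReal.ofReal (|x k| ^ p))
        (fun _ _ => zero_le) (Finset.mem_univ k)
    · exact tendsto_of_tendsto_of_tendsto_of_le_of_le tendsto_const_nhds hcost
        (fun _ => zero_le) fun n => lintegral_mono (hle k)
  have hsum : Tendsto (fun n => ∫⁻ u, pCost p (quantileProcess (μn n) u) (quantileProcess μ u)
      ∂lambdaN N) atTop (𝓝 0) := by
    have hs := tendsto_finsetSum Finset.univ fun k _ => hcoord k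
    rw [Finset.sum_const_zero] at hs
    refine hs.congr fun n => ?_
    have hm : ∀ k, Measurable fun u =>
        edist (quantileProcess (μn n) u k) (quantileProcess μ u k) ^ p := fun k =>
      ((((measurable_pi_apply k).comp (hQn n).measurable).edist
        ((measurable_pi_apply k).comp hQ.measurable)).pow_const p)
    rw [← lintegral_finsetSum _ fun k _ => hm k]
    simp only [pCost_eq_sum_edist hp0.le]
  have := (ENNReal.continuous_rpow_const (y := p⁻¹)).continuousAt.tendsto.comp hsum
  simpa [KRdist, Ldist, hp0.ne', Function.comp_def, ENNReal.zero_rpow_of_pos (inv_pos.2 hp0)]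
    using this

end Metrization

/-- For `p ∈ {0} ∪ [1,∞)` and `μₙ, μ ∈ P_p(ℝ^N)`, convergence in `AW_p`,
convergence in `KR_p`, and `L_p(λ^N)`-convergence (convergence in probability when `p = 0`)
of the quantile processes are all equivalent: `KR_p` metrizes the `p`-adapted weak topology. -/
theorem KR_metrizes_adapted_weak_topology (N : ℕ) (p : ℝ) (hp : p = 0 ∨ 1 ≤ p)
    (μn : ℕ → Measure (Fin N → ℝ)) (μ : Measure (Fin N → ℝ))
    (hμn : ∀ n, MemPp p (μn n)) (hμ : MemPp p μ) :
    (Tendsto (fun n => AWdist p (μn n) μ) atTop (𝓝 0) ↔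
      Tendsto (fun n => KRdist p (μn n) μ) atTop (𝓝 0)) ∧
    (Tendsto (fun n => KRdist p (μn n) μ) atTop (𝓝 0) ↔
      Tendsto (fun n => Ldist p (quantileProcess (μn n)) (quantileProcess μ)) atTop (𝓝 0)) := by
  have := fun n => (hμn n).1
  have := hμ.1
  refine ⟨⟨fun h => ?_, fun h => ?_⟩, Iff.rfl⟩
  · obtain ⟨πn, hπ, hc⟩ := exists_isBicausal_tendsto_transportCost h
    rcases hp with rfl | hp
    · exact tendsto_KRdist_zero_of_tendsto_transportCost hπ hc
    · have hp0 : p ≠ 0 := by linarith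
      exact tendsto_KRdist_of_tendsto_transportCost hp (hμ.2.resolve_left hp0) hπ hc
  · exact tendsto_of_tendsto_of_tendsto_of_le_of_le tendsto_const_nhds h (fun _ => zero_le)
      fun n => AWdist_le_KRdist p (μn n) μ
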